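/- arXiv:0912.3865 — 9 statements merged into one kernel-verified Lean document; each statement's English description precedes it below -/
import Mathlib

section
/- There exist positive constants c1 and c2 such that for every λ > 0 and every t > 0, c1·min(t, t³)·λ³/(1+λ²) ≤ ∫_ℝ (1/(τ²−1)²)·[f_t(λ,τ)² + g_t(λ,τ)²] dτ ≤ c2·(t + t³)·λ³/(1+λ²). (Lemma 3.6) -/
open MeasureTheory Real

open scoped FourierTransform

/-- The Fourier transform of an even integrable real function is its cosine transform. -/
lemma fourier_ofReal_of_even {h : ℝ → ℝ} (hi : Integrable h) (he : ∀ x, h (-x) = h x) (w : ℝ) :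
    𝓕 (fun x => (h x : ℂ)) w = ((∫ x, h x * cos (2 * π * w * x) : ℝ) : ℂ) := by
  have hc : Integrable fun x => h x * cos (2 * π * w * x) :=
    hi.mul_bdd (c := 1) (by fun_prop) (.of_forall fun x => by simpa using abs_cos_le_one _)
  have hs : Integrable fun x => h x * sin (2 * π * w * x) :=
    hi.mul_bdd (c := 1) (by fun_prop) (.of_forall fun x => by simpa using abs_sin_le_one _)
  have h0 : ∫ x, h x * sin (2 * π * w * x) = 0 := by
    have := integral_neg_eq_self (fun x => h x * sin (2 * π * w * x)) volume
    simp only [he, mul_neg, sin_neg, integral_neg] at this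
    linarith
  rw [fourier_real_eq_integral_exp_smul]
  calc _ = ∫ x, (((h x * cos (2 * π * w * x) : ℝ) : ℂ)
        - ((h x * sin (2 * π * w * x) : ℝ) : ℂ) * Complex.I) := by
        congr 1 with x
        rw [Complex.exp_mul_I, ← Complex.ofReal_cos, ← Complex.ofReal_sin,
          show -2 * π * x * w = -(2 * π * w * x) by ring, cos_neg, sin_neg]
        push_cast
        simp only [smul_eq_mul]
        ring
    _ = _ := by
        rw [integral_sub hc.ofReal (hs.ofReal.mul_const _), integral_mul_const,
          integral_complex_ofReal, integral_complex_ofReal, h0]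
        simp

/-- Inversion formula at the origin for the cosine transform of an even function. -/
lemma integral_cos_transform {h : ℝ → ℝ} (hcont : Continuous h) (hi : Integrable h)
    (he : ∀ x, h (-x) = h x) (hC : Integrable fun τ => ∫ x, h x * cos (τ * x)) :
    ∫ τ, ∫ x, h x * cos (τ * x) = 2 * π * h 0 := by
  have hF : 𝓕 (fun x => (h x : ℂ)) =
      fun w => ((∫ x, h x * cos (2 * π * w * x) : ℝ) : ℂ) :=
    funext fun w => fourier_ofReal_of_even hi he w
  have hpi : (2 * π) ≠ 0 := by positivity
  have hF' : Integrable (𝓕 (fun x => (h x : ℂ))) := by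
    rw [hF]
    exact (hC.comp_mul_left' hpi).ofReal
  have key := congrFun (Continuous.fourierInv_fourier_eq (by fun_prop) hi.ofReal hF') 0
  rw [fourierInv_eq', hF] at key
  simp only [inner_zero_right, mul_zero, Complex.ofReal_zero, zero_mul, Complex.exp_zero,
    one_smul, integral_complex_ofReal, Complex.ofReal_inj] at key
  rw [Measure.integral_comp_mul_left (fun τ => ∫ x, h x * cos (τ * x)) (2 * π)] at key
  rw [← key, abs_of_pos (by positivity), smul_eq_mul]
  field_simp

/-- The function `x ↦ 2 ∫ sin s sin (s + x) ds` over `0 ≤ s ≤ s + x ≤ a`, extended evenly: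
twice the autocorrelation of `sin` restricted to `[0, a]`. -/
noncomputable def sinAutocorr (a x : ℝ) : ℝ :=
  max (a - |x|) 0 * cos x - cos a * sin (max (a - |x|) 0)

lemma continuous_sinAutocorr (a : ℝ) : Continuous (sinAutocorr a) := by
  unfold sinAutocorr; fun_prop

lemma sinAutocorr_eq_zero {a x : ℝ} (h : a ≤ |x|) : sinAutocorr a x = 0 := by
  simp [sinAutocorr, max_eq_right (sub_nonpos.2 h)]

lemma integrable_sinAutocorr (a : ℝ) : Integrable (sinAutocorr a) := by
  refine (continuous_sinAutocorr a).integrable_of_hasCompactSupport ?_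
  refine HasCompactSupport.intro (isCompact_Icc (a := -a) (b := a)) fun x hx => ?_
  refine sinAutocorr_eq_zero (le_of_lt ?_)
  by_contra! h
  exact hx (abs_le.1 h)

/-- The spectral density, in the single variable `a = l * t`. -/
noncomputable def waveDensity (a τ : ℝ) : ℝ :=
  (1 / (τ ^ 2 - 1) ^ 2) * ((sin (τ * a) - τ * sin a) ^ 2 + (cos (τ * a) - cos a) ^ 2)

lemma integral_sinAutocorr_mul_cos {a τ : ℝ} (ha : 0 < a) (hτ : τ ^ 2 - 1 ≠ 0) :
    ∫ x, sinAutocorr a x * cos (τ * x) = 2 * waveDensity a τ := by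
  have h1 : ∫ x, sinAutocorr a x * cos (τ * x) =
      2 * ∫ x in Set.Ioi 0, sinAutocorr a x * cos (τ * x) := by
    rw [← integral_comp_abs]
    congr 1 with x
    rcases abs_cases x with h | h <;> simp [sinAutocorr, h.1]
  have h2 : ∫ x in Set.Ioi 0, sinAutocorr a x * cos (τ * x) =
      ∫ x in Set.Ioc 0 a, sinAutocorr a x * cos (τ * x) := by
    refine (setIntegral_eq_of_subset_of_forall_sdiff_eq_zero measurableSet_Ioi
      (fun x hx => hx.1) fun x hx => ?_)
    have hx0 : (0 : ℝ) < x := hx.1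
    have hxa : a ≤ x := by
      by_contra! h
      exact hx.2 ⟨hx0, h.le⟩
    rw [sinAutocorr_eq_zero (by rwa [abs_of_pos hx0]), zero_mul]
  set D := τ ^ 2 - 1 with hD
  let B : ℝ → ℝ := fun x =>
    (a - x) * ((τ * (cos x * sin (τ * x)) - sin x * cos (τ * x)) / D)
    - ((τ ^ 2 + 1) * (cos x * cos (τ * x)) + 2 * τ * (sin x * sin (τ * x))) / D ^ 2
    - cos a * (sin a * ((τ * (cos x * sin (τ * x)) - sin x * cos (τ * x)) / D)
      - cos a * ((τ * (sin x * sin (τ * x)) + cos x * cos (τ * x)) / D))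
  have hB : ∀ x, HasDerivAt B (((a - x) * cos x - cos a * sin (a - x)) * cos (τ * x)) x := by
    intro x
    have hid := hasDerivAt_id x
    have hτx : HasDerivAt (fun x => τ * x) τ x := by simpa using hid.const_mul τ
    have hs := Real.hasDerivAt_sin x
    have hc := Real.hasDerivAt_cos x
    have hS := hτx.sin
    have hC := hτx.cos
    have hP := (((hc.mul hS).const_mul τ).sub (hs.mul hC)).div_const D
    have hQ := (((hs.mul hS).const_mul τ).add (hc.mul hC)).div_const D
    have := ((((hid.const_sub a).mul hP).sub
      ((((hc.mul hC).const_mul (τ ^ 2 + 1)).add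
        ((hs.mul hS).const_mul (2 * τ))).div_const (D ^ 2))).sub
      (((hP.const_mul (sin a)).sub (hQ.const_mul (cos a))).const_mul (cos a)))
    refine this.congr_deriv ?_
    rw [sin_sub]
    simp only [Pi.mul_apply, Pi.sub_apply, id]
    field_simp
    rw [hD]
    ring
  have h3 : ∫ x in Set.Ioc 0 a, sinAutocorr a x * cos (τ * x) = B a - B 0 := by
    rw [← intervalIntegral.integral_of_le ha.le,
      ← intervalIntegral.integral_eq_sub_of_hasDerivAt (fun x _ => hB x)
        (Continuous.intervalIntegrable (by fun_prop) _ _)]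
    refine intervalIntegral.integral_congr fun x hx => ?_
    rw [Set.uIcc_of_le ha.le] at hx
    simp only [sinAutocorr, abs_of_nonneg hx.1, max_eq_left (sub_nonneg.2 hx.2)]
  rw [h1, h2, h3]
  simp only [B, waveDensity, ← hD, mul_zero, sin_zero, cos_zero, sub_self, zero_mul]
  field_simp
  rw [hD]
  have e1 := sin_sq_add_cos_sq a
  have e2 := sin_sq_add_cos_sq (τ * a)
  have e1' : sin a ^ 2 = 1 - cos a ^ 2 := by linarith
  have e2' : sin (τ * a) ^ 2 = 1 - cos (τ * a) ^ 2 := by linarith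
  ring_nf at e1' e2' ⊢
  simp only [e1', e2']
  ring

lemma ae_sq_sub_one_ne_zero : ∀ᵐ τ : ℝ, τ ^ 2 - 1 ≠ 0 := by
  have h : ({1, -1} : Set ℝ)ᶜ ∈ ae volume :=
    compl_mem_ae_iff.2 ((Set.toFinite _).measure_zero _)
  filter_upwards [h] with τ hτ h0
  refine hτ ?_
  simpa using sq_eq_one_iff.1 (sub_eq_zero.1 h0)

lemma integrable_cos_transform_sinAutocorr {a : ℝ} (ha : 0 < a) :
    Integrable fun τ => ∫ x, sinAutocorr a x * cos (τ * x) := by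
  set M := ∫ x, |sinAutocorr a x| with hM
  have hM0 : 0 ≤ M := integral_nonneg fun x => abs_nonneg _
  have hbound : ∀ τ, |∫ x, sinAutocorr a x * cos (τ * x)| ≤ M := by
    intro τ
    refine (norm_integral_le_integral_norm (fun x => sinAutocorr a x * cos (τ * x))).trans ?_
    refine integral_mono_of_nonneg (.of_forall fun x => norm_nonneg _)
      (integrable_sinAutocorr a).abs (.of_forall fun x => ?_)
    simp only [norm_mul, Real.norm_eq_abs]
    exact mul_le_of_le_one_right (abs_nonneg _) (abs_cos_le_one _)
  have hcont : Continuous fun τ => ∫ x, sinAutocorr a x * cos (τ * x) := by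
    refine continuous_of_dominated (bound := fun x => |sinAutocorr a x|) (fun τ => ?_)
      (fun τ => .of_forall fun x => ?_) (integrable_sinAutocorr a).abs
      (.of_forall fun x => by fun_prop)
    · exact ((continuous_sinAutocorr a).mul (by fun_prop)).aestronglyMeasurable
    · simp only [norm_mul, Real.norm_eq_abs]
      exact mul_le_of_le_one_right (abs_nonneg _) (abs_cos_le_one _)
  refine (integrable_inv_one_add_sq.const_mul (5 * M + 40)).mono'
    hcont.aestronglyMeasurable ?_
  refine .of_forall fun τ => ?_
  rw [Real.norm_eq_abs, ← div_eq_mul_inv, le_div_iff₀ (by positivity)]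
  rcases le_total (τ ^ 2) 4 with h | h
  · nlinarith [hbound τ, abs_nonneg (∫ x, sinAutocorr a x * cos (τ * x))]
  · have hD : 3 ≤ τ ^ 2 - 1 := by linarith
    rw [integral_sinAutocorr_mul_cos ha (by linarith), abs_of_nonneg
      (by unfold waveDensity; positivity), waveDensity]
    have hN : (sin (τ * a) - τ * sin a) ^ 2 + (cos (τ * a) - cos a) ^ 2 ≤ 4 * (1 + τ ^ 2) := by
      have h1 := sin_sq_add_cos_sq a
      have h2 := sin_sq_add_cos_sq (τ * a)
      have h3 : sin a ^ 2 ≤ 1 := sin_sq_le_one a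
      have h4 := mul_le_mul_of_nonneg_left h3 (sq_nonneg τ)
      nlinarith [sq_nonneg (sin (τ * a) + τ * sin a), sq_nonneg (cos (τ * a) + cos a),
        sq_nonneg (sin (τ * a)), sq_nonneg (cos a)]
    set N := (sin (τ * a) - τ * sin a) ^ 2 + (cos (τ * a) - cos a) ^ 2
    have hD2 : 0 < (τ ^ 2 - 1) ^ 2 := by positivity
    have h5 : N * (1 + τ ^ 2) ≤ 20 * (τ ^ 2 - 1) ^ 2 := by
      have := mul_le_mul_of_nonneg_right hN (by positivity : 0 ≤ 1 + τ ^ 2)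
      nlinarith
    calc 2 * (1 / (τ ^ 2 - 1) ^ 2 * N) * (1 + τ ^ 2)
        = 2 * (N * (1 + τ ^ 2)) / (τ ^ 2 - 1) ^ 2 := by ring
      _ ≤ 40 := by rw [div_le_iff₀ hD2]; linarith
      _ ≤ 5 * M + 40 := by linarith

/-- The exact value of the spectral integral. -/
lemma integral_waveDensity {a : ℝ} (ha : 0 < a) :
    ∫ τ, waveDensity a τ = π * (a - sin a * cos a) := by
  have h := integral_cos_transform (continuous_sinAutocorr a) (integrable_sinAutocorr a)
    (fun x => by simp [sinAutocorr]) (integrable_cos_transform_sinAutocorr ha)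
  have h' : ∫ τ, ∫ x, sinAutocorr a x * cos (τ * x) = ∫ τ, 2 * waveDensity a τ :=
    integral_congr_ae (ae_sq_sub_one_ne_zero.mono fun τ hτ => integral_sinAutocorr_mul_cos ha hτ)
  rw [h', integral_const_mul] at h
  simp only [sinAutocorr, abs_zero, sub_zero, max_eq_left ha.le, cos_zero, mul_one] at h
  linarith

lemma le_sub_sin_mul_cos {a : ℝ} (ha : 0 < a) :
    a ^ 3 / (1 + a ^ 2) / 3 ≤ a - sin a * cos a := by
  rw [div_div, div_le_iff₀ (by positivity)]
  rcases le_total a 1 with h | h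
  · have hs : sin a ≤ a := sin_le ha.le
    have hc : 0 ≤ cos a := cos_nonneg_of_neg_pi_div_two_le_of_le
      (by linarith [pi_gt_three]) (by linarith [pi_gt_three])
    have hb := (abs_le.1 (cos_bound (x := a) (by rwa [abs_of_pos ha]))).2
    rw [abs_of_pos ha] at hb
    have h4 : a ^ 4 ≤ a ^ 2 := pow_le_pow_of_le_one ha.le h (by norm_num)
    have h1 : sin a * cos a ≤ a * (1 - a ^ 2 / 3) :=
      (mul_le_mul_of_nonneg_right hs hc).trans
        (mul_le_mul_of_nonneg_left (by nlinarith) ha.le)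
    nlinarith [pow_pos ha 3, pow_pos ha 5]
  · have h1 : sin a * cos a ≤ 1 / 2 := by
      nlinarith [sq_nonneg (sin a - cos a), sin_sq_add_cos_sq a]
    nlinarith [pow_pos ha 3]

lemma sub_sin_mul_cos_le {a : ℝ} (ha : 0 < a) :
    a - sin a * cos a ≤ 10 * (a ^ 3 / (1 + a ^ 2)) := by
  rw [← mul_div_assoc, le_div_iff₀ (by positivity)]
  rcases le_total a 1 with h | h
  · have hs := sin_gt_sub_cube (x := 2 * a) (by positivity)
    rw [sin_two_mul] at hs
    have h1 : a - sin a * cos a ≤ a ^ 3 := by nlinarith [pow_pos ha 3]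
    have h2 : a ^ 2 ≤ 1 := pow_le_one₀ ha.le h
    calc (a - sin a * cos a) * (1 + a ^ 2) ≤ a ^ 3 * (1 + a ^ 2) := by gcongr
      _ ≤ a ^ 3 * 10 := by gcongr; linarith
      _ = 10 * a ^ 3 := by ring
  · have h1 : -(1 / 2) ≤ sin a * cos a := by
      nlinarith [sq_nonneg (sin a + cos a), sin_sq_add_cos_sq a]
    nlinarith [pow_pos ha 3]

lemma min_mul_cube_div_le {l t : ℝ} (hl : 0 < l) (ht : 0 < t) :
    min t (t ^ 3) * l ^ 3 / (1 + l ^ 2) ≤ (l * t) ^ 3 / (1 + (l * t) ^ 2) := by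
  rw [div_le_div_iff₀ (by positivity) (by positivity)]
  rcases le_total t 1 with h | h
  · have h2 : t ^ 2 ≤ 1 := pow_le_one₀ ht.le h
    calc _ ≤ t ^ 3 * l ^ 3 * (1 + (l * t) ^ 2) := by gcongr; exact min_le_right _ _
      _ = (l * t) ^ 3 * (1 + l ^ 2 * t ^ 2) := by ring
      _ ≤ _ := by gcongr; exact mul_le_of_le_one_right (by positivity) h2
  · have h2 : 1 ≤ t ^ 2 := one_le_pow₀ h
    calc _ ≤ t * l ^ 3 * (1 + (l * t) ^ 2) := by gcongr; exact min_le_left _ _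
      _ ≤ t * l ^ 3 * (t ^ 2 + (l * t) ^ 2) := by gcongr
      _ = _ := by ring

lemma cube_div_le_add_mul {l t : ℝ} (hl : 0 < l) (ht : 0 < t) :
    (l * t) ^ 3 / (1 + (l * t) ^ 2) ≤ (t + t ^ 3) * l ^ 3 / (1 + l ^ 2) := by
  rw [div_le_div_iff₀ (by positivity) (by positivity)]
  have : 0 ≤ t * l ^ 3 * (1 + t ^ 4 * l ^ 2) := by positivity
  linarith [show (t + t ^ 3) * l ^ 3 * (1 + (l * t) ^ 2) - (l * t) ^ 3 * (1 + l ^ 2)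
    = t * l ^ 3 * (1 + t ^ 4 * l ^ 2) by ring]

/-- Lemma 3.6: two-sided bound for the spectral integral associated with the wave kernel. -/
theorem wave_spectral_integral_bounds :
    ∃ c1 c2 : ℝ, 0 < c1 ∧ 0 < c2 ∧
      ∀ l t : ℝ, 0 < l → 0 < t →
        c1 * min t (t ^ 3) * l ^ 3 / (1 + l ^ 2) ≤
          (∫ τ : ℝ, (1 / (τ ^ 2 - 1) ^ 2) *
            ((Real.sin (τ * l * t) - τ * Real.sin (l * t)) ^ 2 +
             (Real.cos (τ * l * t) - Real.cos (l * t)) ^ 2)) ∧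
        (∫ τ : ℝ, (1 / (τ ^ 2 - 1) ^ 2) *
            ((Real.sin (τ * l * t) - τ * Real.sin (l * t)) ^ 2 +
             (Real.cos (τ * l * t) - Real.cos (l * t)) ^ 2)) ≤
          c2 * (t + t ^ 3) * l ^ 3 / (1 + l ^ 2) := by
  refine ⟨π / 3, 10 * π, by positivity, by positivity, fun l t hl ht => ?_⟩
  have hlt : 0 < l * t := mul_pos hl ht
  have hI : ∫ τ : ℝ, (1 / (τ ^ 2 - 1) ^ 2) * ((sin (τ * l * t) - τ * sin (l * t)) ^ 2 +
      (cos (τ * l * t) - cos (l * t)) ^ 2) = π * (l * t - sin (l * t) * cos (l * t)) := by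
    rw [← integral_waveDensity hlt]
    simp only [waveDensity, mul_assoc]
  rw [hI]
  constructor
  · calc π / 3 * min t (t ^ 3) * l ^ 3 / (1 + l ^ 2)
        = π * (min t (t ^ 3) * l ^ 3 / (1 + l ^ 2) / 3) := by ring
      _ ≤ π * ((l * t) ^ 3 / (1 + (l * t) ^ 2) / 3) := by
        gcongr π * (?_ / 3)
        exact min_mul_cube_div_le hl ht
      _ ≤ _ := by gcongr; exact le_sub_sin_mul_cos hlt
  · calc π * (l * t - sin (l * t) * cos (l * t))
        ≤ π * (10 * ((l * t) ^ 3 / (1 + (l * t) ^ 2))) := by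
          gcongr; exact sub_sin_mul_cos_le hlt
      _ ≤ π * (10 * ((t + t ^ 3) * l ^ 3 / (1 + l ^ 2))) := by
        gcongr π * (10 * ?_)
        exact cube_div_le_add_mul hl ht
      _ = _ := by ring
end

section
/- For every λ > 0 and every t > 0, ∫_ℝ (1/(τ²−1)²)·[f_t(λ,τ)² + g_t(λ,τ)²] dτ = 2π·∫_0^{λt} sin²(x) dx. (Identity established in the proof of Lemma 3.6 via Plancherel's theorem) -/
open MeasureTheory Real

open scoped FourierTransform SchwartzMap ContDiff

/-- The pointwise Fourier integral of an `L¹ ∩ L²` function represents its `L²` Fourier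
transform. -/
theorem fourier_toLp_ae_eq {f : ℝ → ℂ} (hf : Integrable f) (hf₂ : MemLp f 2) :
    ((𝓕 (hf₂.toLp f) : Lp ℂ 2 (volume : Measure ℝ)) : ℝ → ℂ) =ᵐ[volume] 𝓕 f := by
  have hcont : Continuous (𝓕 f) :=
    VectorFourier.fourierIntegral_continuous Real.continuous_fourierChar
      continuous_inner hf
  refine ae_eq_of_integral_contDiff_smul_eq
    ((Lp.memLp _).locallyIntegrable (by norm_num)) hcont.locallyIntegrable ?_
  intro g g_smooth g_cpt
  have hg₁ : HasCompactSupport (Complex.ofRealCLM ∘ g) := g_cpt.comp_left rfl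
  have hg₂ : ContDiff ℝ ∞ (Complex.ofRealCLM ∘ g) := by fun_prop
  let G : 𝓢(ℝ, ℂ) := hg₁.toSchwartzMap hg₂
  have hG (x : ℝ) : G x = (g x : ℂ) := rfl
  calc
    ∫ x, g x • (𝓕 (hf₂.toLp f) : Lp ℂ 2 (volume : Measure ℝ)) x
        = Lp.toTemperedDistribution (𝓕 (hf₂.toLp f)) G := by
          simp [hG]
    _ = ∫ x, 𝓕 G x • hf₂.toLp f x := by
          rw [← Lp.fourier_toTemperedDistribution_eq, TemperedDistribution.fourier_apply,
            Lp.toTemperedDistribution_apply]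
    _ = ∫ x, 𝓕 (G : ℝ → ℂ) x • f x := by
          refine integral_congr_ae ?_
          filter_upwards [hf₂.coeFn_toLp] with x hx
          rw [hx, SchwartzMap.fourier_coe]
    _ = ∫ x, G x • 𝓕 f x := by
          have h := VectorFourier.integral_fourierIntegral_smul_eq_flip (L := innerₗ ℝ)
            Real.continuous_fourierChar continuous_inner
            (G.integrable (μ := volume)) hf
          rw [flip_innerₗ] at h
          exact h
    _ = ∫ x, g x • 𝓕 f x := by simp [hG]

theorem integral_norm_sq_eq_norm_sq (f : Lp ℂ 2 (volume : Measure ℝ)) :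
    ∫ x, ‖f x‖ ^ 2 = ‖f‖ ^ 2 := by
  have h := L2.inner_def (𝕜 := ℂ) f f
  simp only [inner_self_eq_norm_sq_to_K] at h
  have h' : ((‖f‖ ^ 2 : ℝ) : ℂ) = ((∫ x, ‖f x‖ ^ 2 : ℝ) : ℂ) := by
    rw [← integral_complex_ofReal]
    simpa using h
  exact (Complex.ofReal_injective h').symm

/-- Plancherel's identity for the Fourier integral of an `L¹ ∩ L²` function. -/
theorem integral_norm_sq_fourier_eq {f : ℝ → ℂ} (hf : Integrable f) (hf₂ : MemLp f 2) :
    ∫ ξ, ‖𝓕 f ξ‖ ^ 2 = ∫ x, ‖f x‖ ^ 2 := by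
  calc
    ∫ ξ, ‖𝓕 f ξ‖ ^ 2 = ∫ ξ, ‖(𝓕 (hf₂.toLp f) : Lp ℂ 2 (volume : Measure ℝ)) ξ‖ ^ 2 := by
          refine integral_congr_ae ?_
          filter_upwards [fourier_toLp_ae_eq hf hf₂] with x hx
          rw [hx]
    _ = ∫ x, ‖hf₂.toLp f x‖ ^ 2 := by
          rw [integral_norm_sq_eq_norm_sq, integral_norm_sq_eq_norm_sq, Lp.norm_fourier_eq]
    _ = ∫ x, ‖f x‖ ^ 2 := by
          refine integral_congr_ae ?_
          filter_upwards [hf₂.coeFn_toLp] with x hx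
          rw [hx]

theorem one_sub_sq_mul_integral_exp_mul_sin (τ T : ℝ) :
    (1 - (τ : ℂ) ^ 2) * ∫ x in (0 : ℝ)..T, Complex.exp (-(τ * x * Complex.I)) * (Real.sin x : ℂ) =
      1 - Complex.exp (-(τ * T * Complex.I)) * (Real.cos T + τ * Real.sin T * Complex.I) := by
  rw [← intervalIntegral.integral_const_mul,
    intervalIntegral.integral_eq_sub_of_hasDerivAt
      (f := fun x : ℝ ↦ -(Complex.exp (-(τ * x * Complex.I)) *
        (Real.cos x + τ * Real.sin x * Complex.I)))]
  · simp
    ring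
  · intro x _
    have hx : HasDerivAt (fun x : ℝ ↦ (x : ℂ)) 1 x := Complex.ofRealCLM.hasDerivAt
    have he := (((hx.const_mul (τ : ℂ)).mul_const Complex.I).neg).cexp
    have hs := (Real.hasDerivAt_sin x).ofReal_comp
    have hc := (Real.hasDerivAt_cos x).ofReal_comp
    refine ((he.mul (hc.add ((hs.const_mul (τ : ℂ)).mul_const Complex.I))).neg).congr_deriv ?_
    simp only [Pi.neg_apply, Pi.add_apply]
    push_cast
    linear_combination (τ : ℂ) ^ 2 * Complex.sin x *
      Complex.exp (-(τ * x * Complex.I)) * Complex.I_sq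
  · exact Continuous.intervalIntegrable (by fun_prop) _ _

theorem normSq_one_sub_exp_mul (τ T : ℝ) :
    ‖1 - Complex.exp (-(τ * T * Complex.I)) * (Real.cos T + τ * Real.sin T * Complex.I)‖ ^ 2 =
      (Real.sin (τ * T) - τ * Real.sin T) ^ 2 + (Real.cos (τ * T) - Real.cos T) ^ 2 := by
  have h : 1 - Complex.exp (-(τ * T * Complex.I)) * (Real.cos T + τ * Real.sin T * Complex.I) =
      Complex.exp ((-(τ * T) : ℝ) * Complex.I) *
        (((Real.cos (τ * T) - Real.cos T : ℝ) : ℂ) +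
          ((Real.sin (τ * T) - τ * Real.sin T : ℝ) : ℂ) * Complex.I) := by
    have h₁ : Complex.exp ((-(τ * T) : ℝ) * Complex.I) * Complex.exp (τ * T * Complex.I) = 1 := by
      rw [← Complex.exp_add]
      simp
    have h₂ := Complex.exp_mul_I (τ * T : ℂ)
    have h₃ : Complex.exp (-(τ * T * Complex.I)) = Complex.exp ((-(τ * T) : ℝ) * Complex.I) := by
      simp
    rw [h₂] at h₁
    rw [h₃]
    push_cast at h₁ ⊢
    linear_combination -h₁
  rw [h, norm_mul, Complex.norm_exp_ofReal_mul_I, one_mul, Complex.sq_norm,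
    Complex.normSq_add_mul_I]
  ring

/-- Identity from the proof of Lemma 3.6 (via Plancherel). -/
theorem wave_spectral_integral_eq (l t : ℝ) (hl : 0 < l) (ht : 0 < t) :
    (∫ τ : ℝ, (1 / (τ ^ 2 - 1) ^ 2) *
        ((Real.sin (τ * l * t) - τ * Real.sin (l * t)) ^ 2 +
         (Real.cos (τ * l * t) - Real.cos (l * t)) ^ 2)) =
      2 * Real.pi * ∫ x in (0 : ℝ)..(l * t), Real.sin x ^ 2 := by
  simp_rw [mul_assoc _ l t]
  have hT : 0 ≤ l * t := by positivity
  generalize l * t = T at hT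
  let f : ℝ → ℂ := (Set.Ioc 0 T).indicator fun x ↦ (Real.sin x : ℂ)
  let J (τ : ℝ) : ℂ :=
    ∫ x in (0 : ℝ)..T, Complex.exp (-(τ * x * Complex.I)) * (Real.sin x : ℂ)
  have hbdd : ∀ p, MemLp f p := fun p ↦ by
    rw [memLp_indicator_iff_restrict measurableSet_Ioc]
    refine MemLp.of_bound (by fun_prop) 1 (.of_forall fun x ↦ ?_)
    rw [Complex.norm_real]
    exact Real.abs_sin_le_one x
  have hF (ξ : ℝ) : 𝓕 f ξ = J (2 * π * ξ) := by
    simp only [J, f, Real.fourier_eq']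
    rw [intervalIntegral.integral_of_le hT, ← integral_indicator measurableSet_Ioc]
    congr 1 with x
    by_cases hx : x ∈ Set.Ioc 0 T
    · simp only [Set.indicator_of_mem hx, smul_eq_mul]
      congr 2
      simp
      ring
    · simp [Set.indicator_of_notMem hx]
  have hJ (τ : ℝ) (hτ : τ ^ 2 - 1 ≠ 0) : ‖J τ‖ ^ 2 = (1 / (τ ^ 2 - 1) ^ 2) *
      ((Real.sin (τ * T) - τ * Real.sin T) ^ 2 + (Real.cos (τ * T) - Real.cos T) ^ 2) := by
    rw [← normSq_one_sub_exp_mul, ← one_sub_sq_mul_integral_exp_mul_sin, norm_mul, mul_pow]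
    have h : ‖1 - (τ : ℂ) ^ 2‖ ^ 2 = (τ ^ 2 - 1) ^ 2 := by
      rw [← Complex.ofReal_pow, ← Complex.ofReal_one, ← Complex.ofReal_sub, Complex.norm_real,
        Real.norm_eq_abs, sq_abs]
      ring
    rw [h]
    field_simp
    rfl
  calc
    _ = ∫ τ, ‖J τ‖ ^ 2 := by
      refine integral_congr_ae ?_
      filter_upwards [(Set.toFinite {(1 : ℝ), -1}).countable.ae_notMem volume] with τ hτ
      refine (hJ τ fun h ↦ hτ ?_).symm
      simpa using sub_eq_zero.mp h
    _ = 2 * π * ∫ ξ, ‖𝓕 f ξ‖ ^ 2 := by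
      simp_rw [hF]
      rw [Measure.integral_comp_mul_left (fun τ ↦ ‖J τ‖ ^ 2), abs_of_pos (by positivity),
        smul_eq_mul, mul_inv_cancel_left₀ (by positivity)]
    _ = 2 * π * ∫ x in (0 : ℝ)..T, Real.sin x ^ 2 := by
      rw [integral_norm_sq_fourier_eq (memLp_one_iff_integrable.mp (hbdd 1)) (hbdd 2),
        intervalIntegral.integral_of_le hT, ← integral_indicator measurableSet_Ioc]
      congr 2 with x
      by_cases hx : x ∈ Set.Ioc 0 T
      · simp only [f, Set.indicator_of_mem hx, Complex.norm_real, Real.norm_eq_abs, sq_abs]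
      · simp [f, Set.indicator_of_notMem hx]
end

section
/- Let H ∈ (1/2, 1) and T > 0. Then α_H·∫_0^T ∫_0^T sin(u)·sin(v)·|u−v|^{2H−2} du dv = c_H·∫_ℝ [(sin(τT) − τ·sin T)² + (cos(τT) − cos T)²]/(τ²−1)² · |τ|^{−(2H−1)} dτ. (Lemma B.1) -/
open MeasureTheory Real

/-- The Gamma integral after the substitution `r ↦ 1 / r`. -/
theorem integrableOn_and_integral_rpow_mul_exp_neg_div {q a : ℝ} (hq : 0 < q) (ha : 0 < a) :
    IntegrableOn (fun r : ℝ => r ^ (-q - 1) * exp (-(a / r))) (Set.Ioi 0) ∧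
      ∫ r in Set.Ioi (0 : ℝ), r ^ (-q - 1) * exp (-(a / r)) = a ^ (-q) * Gamma q := by
  have key : ∫ r in Set.Ioi (0 : ℝ), r ^ (-q - 1) * exp (-(a / r)) = a ^ (-q) * Gamma q := by
    have h := integral_rpow_mul_exp_neg_mul_Ioi hq ha
    rw [one_div, inv_rpow ha.le, ← rpow_neg ha.le,
      ← integral_comp_rpow_Ioi (fun t : ℝ => t ^ (q - 1) * exp (-(a * t)))
        (show (-1 : ℝ) ≠ 0 by norm_num)] at h
    rw [← h]
    refine setIntegral_congr_fun measurableSet_Ioi fun r (hr : 0 < r) => ?_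
    simp only [abs_neg, abs_one, one_mul, smul_eq_mul, ← mul_assoc, rpow_neg_one, div_eq_mul_inv]
    rw [inv_rpow hr.le, ← rpow_neg hr.le, ← rpow_add hr]
    congr 2
    ring
  have : 0 < Gamma q := Gamma_pos_of_pos hq
  exact ⟨.of_integral_ne_zero (by rw [key]; positivity), key⟩

/-- The cosine transform of a Gaussian. -/
theorem integral_exp_neg_mul_sq_mul_cos {r : ℝ} (hr : 0 < r) (x : ℝ) :
    ∫ τ : ℝ, exp (-r * τ ^ 2) * cos (τ * x) = √(π / r) * exp (-(x ^ 2 / 4 / r)) := by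
  have h := congrArg Complex.re (fourierIntegral_gaussian (b := r) (by simpa using hr) x)
  have e (τ : ℝ) : Complex.exp (Complex.I * x * τ) * Complex.exp (-r * τ ^ 2) =
      ((exp (-r * τ ^ 2) : ℝ) : ℂ) * Complex.exp ((τ * x : ℝ) * Complex.I) := by
    push_cast
    rw [mul_comm]
    congr 2
    ring
  have hint : Integrable fun τ : ℝ =>
      ((exp (-r * τ ^ 2) : ℝ) : ℂ) * Complex.exp ((τ * x : ℝ) * Complex.I) := by
    refine (integrable_exp_neg_mul_sq hr).ofReal.mul_bdd (c := 1) (by fun_prop) ?_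
    exact .of_forall fun τ => (Complex.norm_exp_ofReal_mul_I _).le
  have h3 : ((π : ℂ) / r) ^ (1 / 2 : ℂ) * Complex.exp (-(x : ℂ) ^ 2 / (4 * r)) =
      ((√(π / r) * exp (-(x ^ 2 / 4 / r)) : ℝ) : ℂ) := by
    rw [sqrt_eq_rpow, Complex.ofReal_mul, Complex.ofReal_cpow (by positivity)]
    push_cast
    congr 2
    field_simp
  simp_rw [e] at h
  rw [h3, Complex.ofReal_re] at h
  rw [← h]
  have := integral_re hint
  simp only [RCLike.re_eq_complex_re] at this
  rw [← this]
  simp only [Complex.re_ofReal_mul, Complex.exp_ofReal_mul_I_re]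

theorem integral_integral_mul_cos_sub {μ : Measure ℝ} [SFinite μ] {f : ℝ → ℝ}
    (hf : Integrable f μ) (τ : ℝ) :
    ∫ z, f z.1 * f z.2 * cos (τ * (z.1 - z.2)) ∂μ.prod μ =
      (∫ u, f u * cos (τ * u) ∂μ) ^ 2 + (∫ u, f u * sin (τ * u) ∂μ) ^ 2 := by
  have hc : Integrable (fun u => f u * cos (τ * u)) μ :=
    hf.mul_bdd (c := 1) (by fun_prop) (.of_forall fun u => abs_cos_le_one _)
  have hs : Integrable (fun u => f u * sin (τ * u)) μ :=
    hf.mul_bdd (c := 1) (by fun_prop) (.of_forall fun u => abs_sin_le_one _)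
  rw [sq, sq, ← integral_prod_mul, ← integral_prod_mul,
    ← integral_add (hc.mul_prod hc) (hs.mul_prod hs)]
  congr 1 with z
  rw [mul_sub, cos_sub]
  ring

theorem integrable_and_integral_gaussian_energy {μ : Measure ℝ} [SFinite μ] {f : ℝ → ℝ}
    (hf : Integrable f μ) {r : ℝ} (hr : 0 < r) :
    Integrable (fun τ : ℝ => exp (-r * τ ^ 2) *
        ((∫ u, f u * cos (τ * u) ∂μ) ^ 2 + (∫ u, f u * sin (τ * u) ∂μ) ^ 2)) ∧
      ∫ τ : ℝ, exp (-r * τ ^ 2) *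
        ((∫ u, f u * cos (τ * u) ∂μ) ^ 2 + (∫ u, f u * sin (τ * u) ∂μ) ^ 2) =
      √(π / r) * ∫ z, f z.1 * f z.2 * exp (-((z.1 - z.2) ^ 2 / 4 / r)) ∂μ.prod μ := by
  have hint : Integrable (fun w : ℝ × ℝ × ℝ =>
      exp (-r * w.1 ^ 2) * (f w.2.1 * f w.2.2) * cos (w.1 * (w.2.1 - w.2.2)))
      (volume.prod (μ.prod μ)) :=
    ((integrable_exp_neg_mul_sq hr).mul_prod (hf.mul_prod hf)).mul_bdd (c := 1)
      (by fun_prop) (.of_forall fun u => abs_cos_le_one _)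
  have e (τ : ℝ) : exp (-r * τ ^ 2) *
        ((∫ u, f u * cos (τ * u) ∂μ) ^ 2 + (∫ u, f u * sin (τ * u) ∂μ) ^ 2) =
      ∫ z, exp (-r * τ ^ 2) * (f z.1 * f z.2) * cos (τ * (z.1 - z.2)) ∂μ.prod μ := by
    rw [← integral_integral_mul_cos_sub hf, ← integral_const_mul]
    simp only [mul_assoc]
  simp_rw [e]
  refine ⟨hint.integral_prod_left, ?_⟩
  rw [integral_integral_swap hint, ← integral_const_mul]
  congr 1 with z
  rw [mul_left_comm, ← integral_exp_neg_mul_sq_mul_cos hr, ← integral_const_mul]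
  congr 1 with τ
  ring

/-- The Riesz energy of `f ∂μ` with kernel `|x| ^ (-2q)`, `0 < q < 1/2`, in spectral form. The kernel
is written as a Gaussian mixture, whose Fourier transform is again a Gaussian mixture. -/
theorem riesz_energy_eq_integral_fourier {μ : Measure ℝ} [SFinite μ]
    [NullSingletonClass μ] {f : ℝ → ℝ}
    (hf : Integrable f μ) {q : ℝ} (hq₀ : 0 < q) (hq₁ : q < 1 / 2)
    (hK : Integrable (fun z : ℝ × ℝ => f z.1 * f z.2 * |z.1 - z.2| ^ (-(2 * q))) (μ.prod μ)) :
    √π * 4 ^ q * Gamma q * ∫ z, f z.1 * f z.2 * |z.1 - z.2| ^ (-(2 * q)) ∂μ.prod μ =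
      Gamma (1 / 2 - q) * ∫ τ : ℝ,
        ((∫ u, f u * cos (τ * u) ∂μ) ^ 2 + (∫ u, f u * sin (τ * u) ∂μ) ^ 2) *
          |τ| ^ (2 * q - 1) := by
  set G : ℝ → ℝ := fun τ => (∫ u, f u * cos (τ * u) ∂μ) ^ 2 + (∫ u, f u * sin (τ * u) ∂μ) ^ 2
    with hG
  have hG0 (τ : ℝ) : 0 ≤ G τ := by positivity
  have hGc : Continuous G := by
    refine .add (.pow ?_ 2) (.pow ?_ 2)
    · refine continuous_of_dominated (bound := fun u => ‖f u‖)
        (fun τ => hf.1.mul (by fun_prop)) (fun τ => .of_forall fun u => ?_) hf.norm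
        (.of_forall fun u => by fun_prop)
      rw [norm_mul]
      exact mul_le_of_le_one_right (norm_nonneg _) (abs_cos_le_one _)
    · refine continuous_of_dominated (bound := fun u => ‖f u‖)
        (fun τ => hf.1.mul (by fun_prop)) (fun τ => .of_forall fun u => ?_) hf.norm
        (.of_forall fun u => by fun_prop)
      rw [norm_mul]
      exact mul_le_of_le_one_right (norm_nonneg _) (abs_sin_le_one _)
  have hdiag : ∀ᵐ z ∂μ.prod μ, z.1 ≠ z.2 := by
    have : MeasurableSet {z : ℝ × ℝ | z.1 = z.2} := measurableSet_eq_fun (by fun_prop) (by fun_prop)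
    rw [ae_iff]
    simp only [ne_eq, not_not]
    rw [Measure.measure_prod_null this]
    refine .of_forall fun u => ?_
    have : Prod.mk u ⁻¹' {z : ℝ × ℝ | z.1 = z.2} = {u} := by ext; simp [eq_comm]
    simp [this]
  have hker {z : ℝ × ℝ} (hz : z.1 ≠ z.2) :
      IntegrableOn (fun r : ℝ => r ^ (-q - 1) * exp (-((z.1 - z.2) ^ 2 / 4 / r))) (Set.Ioi 0) ∧
      ∫ r in Set.Ioi (0 : ℝ), r ^ (-q - 1) * exp (-((z.1 - z.2) ^ 2 / 4 / r)) =
        4 ^ q * Gamma q * |z.1 - z.2| ^ (-(2 * q)) := by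
    have hz' : 0 < |z.1 - z.2| := abs_pos.mpr (sub_ne_zero.mpr hz)
    have := integrableOn_and_integral_rpow_mul_exp_neg_div hq₀
      (a := (z.1 - z.2) ^ 2 / 4) (by rw [← sq_abs]; positivity)
    refine ⟨this.1, this.2.trans ?_⟩
    rw [← sq_abs, div_rpow (by positivity) (by norm_num), ← rpow_natCast, ← rpow_mul hz'.le,
      rpow_neg (by norm_num : (0 : ℝ) ≤ 4), div_inv_eq_mul]
    push_cast
    rw [mul_neg]
    ring
  set ν : Measure ℝ := volume.restrict (Set.Ioi 0)
  have hA : Integrable (fun w : ℝ × ℝ × ℝ => w.1 ^ (-q - 1) *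
      (f w.2.1 * f w.2.2 * exp (-((w.2.1 - w.2.2) ^ 2 / 4 / w.1)))) (ν.prod (μ.prod μ)) := by
    have hm : AEStronglyMeasurable (fun w : ℝ × ℝ × ℝ => w.1 ^ (-q - 1) *
        (f w.2.1 * f w.2.2 * exp (-((w.2.1 - w.2.2) ^ 2 / 4 / w.1)))) (ν.prod (μ.prod μ)) := by
      refine .mul (Measurable.aestronglyMeasurable (by fun_prop))
        (.mul (hf.1.comp_fst.mul hf.1.comp_snd).comp_snd ?_)
      exact Measurable.aestronglyMeasurable (by fun_prop)
    rw [integrable_prod_iff' hm]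
    constructor
    · filter_upwards [hdiag] with z hz
      refine ((hker hz).1.const_mul (f z.1 * f z.2)).congr (.of_forall fun r => ?_)
      simp only
      ring
    · refine (hK.norm.const_mul (4 ^ q * Gamma q)).congr ?_
      filter_upwards [hdiag] with z hz
      rw [norm_mul, mul_left_comm, norm_of_nonneg (by positivity : 0 ≤ |z.1 - z.2| ^ (-(2 * q))),
        ← (hker hz).2, ← integral_const_mul]
      refine setIntegral_congr_fun measurableSet_Ioi fun r (hr : 0 < r) => ?_
      simp only [norm_mul, norm_of_nonneg (exp_pos _).le, norm_of_nonneg (rpow_nonneg hr.le _)]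
      ring
  have hAval : ∫ r, r ^ (-q - 1) *
      ∫ z, f z.1 * f z.2 * exp (-((z.1 - z.2) ^ 2 / 4 / r)) ∂μ.prod μ ∂ν =
      4 ^ q * Gamma q * ∫ z, f z.1 * f z.2 * |z.1 - z.2| ^ (-(2 * q)) ∂μ.prod μ := by
    simp_rw [← integral_const_mul]
    rw [integral_integral_swap hA]
    refine integral_congr_ae ?_
    filter_upwards [hdiag] with z hz
    rw [mul_left_comm, ← (hker hz).2, ← integral_const_mul]
    congr 1 with r
    ring
  have hrow {r : ℝ} (hr : 0 < r) : ∫ τ, r ^ (1 / 2 - q - 1) * (exp (-r * τ ^ 2) * G τ) =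
      √π * (r ^ (-q - 1) * ∫ z, f z.1 * f z.2 * exp (-((z.1 - z.2) ^ 2 / 4 / r)) ∂μ.prod μ) := by
    rw [integral_const_mul, (integrable_and_integral_gaussian_energy hf hr).2,
      sqrt_div pi_pos.le, sqrt_eq_rpow r, div_eq_mul_inv (√π), ← rpow_neg hr.le,
      show -q - 1 = (1 / 2 - q - 1) + -(1 / 2) by ring, rpow_add hr]
    ring
  have hB : Integrable (fun w : ℝ × ℝ => w.1 ^ (1 / 2 - q - 1) * (exp (-w.1 * w.2 ^ 2) * G w.2))
      (ν.prod volume) := by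
    rw [integrable_prod_iff (Measurable.aestronglyMeasurable (by fun_prop))]
    have hpos : ∀ᵐ r ∂ν, 0 < r := ae_restrict_mem measurableSet_Ioi
    constructor
    · filter_upwards [hpos] with r hr
      exact (integrable_and_integral_gaussian_energy hf hr).1.const_mul _
    · refine (hA.integral_prod_left.const_mul (√π)).congr ?_
      filter_upwards [hpos] with r hr
      rw [integral_const_mul, ← hrow hr]
      congr 1 with τ
      exact (norm_of_nonneg (mul_nonneg (rpow_nonneg hr.le _)
        (mul_nonneg (exp_pos _).le (hG0 τ)))).symm
  rw [mul_assoc, mul_assoc, ← mul_assoc (4 ^ q), ← hAval, ← integral_const_mul,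
    ← integral_const_mul]
  calc _ = ∫ r, ∫ τ, r ^ (1 / 2 - q - 1) * (exp (-r * τ ^ 2) * G τ) ∂volume ∂ν :=
        setIntegral_congr_fun measurableSet_Ioi fun r hr => (hrow hr).symm
    _ = ∫ τ, ∫ r, r ^ (1 / 2 - q - 1) * (exp (-r * τ ^ 2) * G τ) ∂ν ∂volume :=
        integral_integral_swap hB
    _ = _ := by
      refine integral_congr_ae ?_
      filter_upwards [Measure.ae_ne volume (0 : ℝ)] with τ hτ
      have hτ' : 0 < |τ| := abs_pos.mpr hτ
      have h := integral_rpow_mul_exp_neg_mul_Ioi (a := 1 / 2 - q) (r := τ ^ 2)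
        (by linarith) (by positivity)
      rw [one_div (τ ^ 2), ← sq_abs, ← rpow_natCast, ← rpow_neg hτ'.le, ← rpow_mul hτ'.le,
        show -((2 : ℕ) : ℝ) * (1 / 2 - q) = 2 * q - 1 by push_cast; ring, mul_comm] at h
      rw [mul_left_comm, ← h, ← integral_const_mul]
      congr 1 with r
      simp only [hG, rpow_natCast, sq_abs]
      ring_nf

theorem one_sub_sq_mul_integral_sin_mul_cos (τ T : ℝ) :
    (1 - τ ^ 2) * ∫ u in (0 : ℝ)..T, sin u * cos (τ * u) =
      1 - cos T * cos (τ * T) - τ * sin T * sin (τ * T) := by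
  rw [← intervalIntegral.integral_const_mul,
    intervalIntegral.integral_eq_sub_of_hasDerivAt
      (f := fun u => -cos u * cos (τ * u) - τ * sin u * sin (τ * u)) (fun u _ => ?_)
      (Continuous.intervalIntegrable (by fun_prop) _ _)]
  · simp
    ring
  · have hlin : HasDerivAt (fun u => τ * u) τ u := by simpa using (hasDerivAt_id u).const_mul τ
    convert! ((hasDerivAt_cos u).neg.mul hlin.cos).sub
      (((hasDerivAt_sin u).const_mul τ).mul hlin.sin) using 1
    simp
    ring

theorem one_sub_sq_mul_integral_sin_mul_sin (τ T : ℝ) :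
    (1 - τ ^ 2) * ∫ u in (0 : ℝ)..T, sin u * sin (τ * u) =
      τ * sin T * cos (τ * T) - cos T * sin (τ * T) := by
  rw [← intervalIntegral.integral_const_mul,
    intervalIntegral.integral_eq_sub_of_hasDerivAt
      (f := fun u => τ * sin u * cos (τ * u) - cos u * sin (τ * u)) (fun u _ => ?_)
      (Continuous.intervalIntegrable (by fun_prop) _ _)]
  · simp
  · have hlin : HasDerivAt (fun u => τ * u) τ u := by simpa using (hasDerivAt_id u).const_mul τ
    convert! (((hasDerivAt_sin u).const_mul τ).mul hlin.cos).sub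
      ((hasDerivAt_cos u).mul hlin.sin) using 1
    simp
    ring

theorem sq_add_sq_integral_sin_eq {τ : ℝ} (hτ : τ ^ 2 ≠ 1) (T : ℝ) :
    (∫ u in (0 : ℝ)..T, sin u * cos (τ * u)) ^ 2 + (∫ u in (0 : ℝ)..T, sin u * sin (τ * u)) ^ 2 =
      ((sin (τ * T) - τ * sin T) ^ 2 + (cos (τ * T) - cos T) ^ 2) / (τ ^ 2 - 1) ^ 2 := by
  rw [eq_div_iff (pow_ne_zero 2 (sub_ne_zero.mpr hτ))]
  have hc := one_sub_sq_mul_integral_sin_mul_cos τ T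
  have hs := one_sub_sq_mul_integral_sin_mul_sin τ T
  calc _ = ((1 - τ ^ 2) * ∫ u in (0 : ℝ)..T, sin u * cos (τ * u)) ^ 2 +
        ((1 - τ ^ 2) * ∫ u in (0 : ℝ)..T, sin u * sin (τ * u)) ^ 2 := by ring
    _ = _ := by
      rw [hc, hs]
      linear_combination (τ ^ 2 * sin T ^ 2 + cos T ^ 2 - 1) * sin_sq_add_cos_sq (τ * T)

theorem integrable_prod_restrict_abs_sub_rpow {b : ℝ} (hb : -1 < b) {T : ℝ} (hT : 0 < T) :
    Integrable (fun z : ℝ × ℝ => |z.1 - z.2| ^ b)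
      ((volume.restrict (Set.Ioc 0 T)).prod (volume.restrict (Set.Ioc 0 T))) := by
  have hg : Integrable ((Set.Ioc (-T) T).indicator fun y : ℝ => |y| ^ b) := by
    rw [integrable_indicator_iff measurableSet_Ioc]
    have h : IntervalIntegrable (fun y : ℝ => |y| ^ b) volume 0 T :=
      (intervalIntegral.intervalIntegrable_rpow' hb).congr fun y hy => by
        rw [Set.uIoc_of_le hT.le] at hy
        simp only [abs_of_pos hy.1]
    have h' : IntervalIntegrable (fun y : ℝ => |y| ^ b) volume (-T) 0 := by
      rw [IntervalIntegrable.iff_comp_neg]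
      simpa using h.symm
    exact (intervalIntegrable_iff_integrableOn_Ioc_of_le (by linarith)).mp (h'.trans h)
  have hf : Integrable ((Set.Ioc 0 T).indicator fun _ : ℝ => (1 : ℝ)) :=
    (integrable_indicator_iff measurableSet_Ioc).mpr (by simp)
  have h := hf.convolution_integrand (ContinuousLinearMap.mul ℝ ℝ) hg
  rw [Measure.prod_restrict]
  refine h.integrableOn.congr_fun (fun z hz => ?_) (measurableSet_Ioc.prod measurableSet_Ioc)
  obtain ⟨⟨h₁, h₂⟩, h₃, h₄⟩ := hz
  have hmem : z.1 - z.2 ∈ Set.Ioc (-T) T := ⟨by linarith, by linarith⟩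
  simp [h₃, h₄, Set.indicator_of_mem hmem]

/-- Lemma B.1: the `𝓗(0,T)`-norm of `sin` in spectral form. -/
theorem H_norm_sin (H T : ℝ) (hH : H ∈ Set.Ioo (1/2 : ℝ) 1) (hT : 0 < T) :
    H * (2 * H - 1) *
      ∫ u in (0 : ℝ)..T, ∫ v in (0 : ℝ)..T,
        Real.sin u * Real.sin v * |u - v| ^ (2 * H - 2) =
    (Real.Gamma (2 * H + 1) * Real.sin (Real.pi * H) / (2 * Real.pi)) *
      ∫ τ : ℝ,
        ((Real.sin (τ * T) - τ * Real.sin T) ^ 2 +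
          (Real.cos (τ * T) - Real.cos T) ^ 2) / (τ ^ 2 - 1) ^ 2 *
        |τ| ^ (-(2 * H - 1)) := by
  obtain ⟨hH₀, hH₁⟩ := hH
  set μ : Measure ℝ := volume.restrict (Set.Ioc 0 T)
  have hsin : Integrable sin μ := (continuous_sin.integrableOn_Icc).mono_set Set.Ioc_subset_Icc_self
  have hK : Integrable (fun z : ℝ × ℝ => sin z.1 * sin z.2 * |z.1 - z.2| ^ (-(2 * (1 - H))))
      (μ.prod μ) := by
    refine (integrable_prod_restrict_abs_sub_rpow (by linarith) hT).bdd_mul (c := 1)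
      (by fun_prop) (.of_forall fun z => ?_)
    rw [norm_mul]
    exact mul_le_one₀ (abs_sin_le_one _) (norm_nonneg _) (abs_sin_le_one _)
  have key := riesz_energy_eq_integral_fourier hsin (q := 1 - H) (by linarith) (by linarith) hK
  rw [integral_prod _ hK] at key
  have hspec : ∫ τ : ℝ, ((sin (τ * T) - τ * sin T) ^ 2 + (cos (τ * T) - cos T) ^ 2) /
        (τ ^ 2 - 1) ^ 2 * |τ| ^ (-(2 * H - 1)) =
      ∫ τ : ℝ, ((∫ u, sin u * cos (τ * u) ∂μ) ^ 2 + (∫ u, sin u * sin (τ * u) ∂μ) ^ 2) *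
        |τ| ^ (2 * (1 - H) - 1) := by
    refine integral_congr_ae ?_
    filter_upwards [Measure.ae_ne volume (1 : ℝ), Measure.ae_ne volume (-1 : ℝ)] with τ h₁ h₂
    rw [← sq_add_sq_integral_sin_eq (by simp [sq_eq_one_iff, h₁, h₂]),
      intervalIntegral.integral_of_le hT.le, intervalIntegral.integral_of_le hT.le]
    congr 2
    ring
  simp_rw [intervalIntegral.integral_of_le hT.le, hspec, show 2 * H - 2 = -(2 * (1 - H)) by ring]
  have hdup := Gamma_mul_Gamma_add_half (H - 1 / 2)
  have hrefl := Gamma_mul_Gamma_one_sub H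
  have hG : Gamma (2 * H + 1) = 2 * H * ((2 * H - 1) * Gamma (2 * H - 1)) := by
    rw [← Gamma_add_one (by linarith), sub_add_cancel, Gamma_add_one (by linarith)]
  have hpow : (2 : ℝ) ^ (1 - 2 * (H - 1 / 2)) = 4 ^ (1 - H) := by
    rw [show (4 : ℝ) = 2 ^ (2 : ℝ) by norm_num, ← rpow_mul zero_le_two]
    congr 1
    ring
  have hsinpos : 0 < sin (π * H) :=
    sin_pos_of_pos_of_lt_pi (by positivity) (mul_lt_of_lt_one_right pi_pos hH₁)
  rw [hpow, sub_add_cancel, show 2 * (H - 1 / 2) = 2 * H - 1 by ring] at hdup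
  rw [eq_div_iff hsinpos.ne'] at hrefl
  rw [show 1 / 2 - (1 - H) = H - 1 / 2 by ring] at key
  set I := ∫ u, ∫ v, sin u * sin v * |u - v| ^ (-(2 * (1 - H))) ∂μ ∂μ
  set J := ∫ τ : ℝ, ((∫ u, sin u * cos (τ * u) ∂μ) ^ 2 + (∫ u, sin u * sin (τ * u) ∂μ) ^ 2) *
    |τ| ^ (2 * (1 - H) - 1)
  have hI : I = Gamma (2 * H - 1) * sin (π * H) * J / π := by
    rw [eq_div_iff pi_ne_zero]
    refine mul_left_cancel₀ (show √π * 4 ^ (1 - H) ≠ 0 by positivity) ?_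
    linear_combination Gamma H * sin (π * H) * key - √π * 4 ^ (1 - H) * I * hrefl +
      sin (π * H) * J * hdup
  rw [hG, hI]
  ring
end

section
/- Let H ∈ (1/2, 1). There exists a constant C_H > 0, depending only on H, such that for every t > 0 and every λ with 0 < λ ≤ 1, N_t(λ) ≤ C_H · t^{2H+2} · (1/(1+λ²))^{H+1/2}. (Proposition 3.7, case |ξ| ≤ 1) -/
open MeasureTheory Real

lemma integral_abs_rpow_of_nonneg {p x : ℝ} (hp : -1 < p) (hx : 0 ≤ x) :
    ∫ w in (0 : ℝ)..x, |w| ^ p = x ^ (p + 1) / (p + 1) := by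
  have h : ∫ w in (0 : ℝ)..x, |w| ^ p = ∫ w in (0 : ℝ)..x, w ^ p := by
    refine intervalIntegral.integral_congr fun w hw => ?_
    rw [Set.uIcc_of_le hx] at hw
    simp only [abs_of_nonneg hw.1]
  rw [h, integral_rpow (Or.inl hp), zero_rpow (by linarith), sub_zero]

lemma intervalIntegrable_abs_rpow {p : ℝ} (hp : -1 < p) (a b : ℝ) :
    IntervalIntegrable (fun w : ℝ => |w| ^ p) volume a b := by
  refine intervalIntegrable_of_even (fun w => by rw [abs_neg]) fun x hx => ?_
  refine (intervalIntegral.intervalIntegrable_rpow' hp).congr fun w hw => ?_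
  rw [Set.uIoc_of_le hx.le] at hw
  simp only [abs_of_pos hw.1]

lemma integral_abs_sub_rpow_le {p t u : ℝ} (hp : -1 < p) (hu : u ∈ Set.Icc 0 t) :
    ∫ v in (0 : ℝ)..t, |u - v| ^ p ≤ 2 * (t ^ (p + 1) / (p + 1)) := by
  obtain ⟨hu0, hut⟩ := hu
  have hp1 : 0 < p + 1 := by linarith
  have hneg : ∫ w in (u - t)..0, |w| ^ p = ∫ w in (0 : ℝ)..(t - u), |w| ^ p := by
    have h := intervalIntegral.integral_comp_neg (a := 0) (b := t - u) fun w : ℝ => |w| ^ p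
    simpa only [abs_neg, neg_zero, neg_sub] using h.symm
  rw [intervalIntegral.integral_comp_sub_left (fun w : ℝ => |w| ^ p), sub_zero,
    ← intervalIntegral.integral_add_adjacent_intervals
      (intervalIntegrable_abs_rpow hp (u - t) 0) (intervalIntegrable_abs_rpow hp 0 u),
    hneg, integral_abs_rpow_of_nonneg hp (sub_nonneg.2 hut), integral_abs_rpow_of_nonneg hp hu0,
    two_mul]
  gcongr
  linarith

lemma abs_sin_mul_le {u t l : ℝ} (hl : 0 ≤ l) (hu : u ∈ Set.Icc 0 t) :
    |sin (u * l)| ≤ t * l := by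
  refine abs_sin_le_abs.trans ?_
  rw [abs_of_nonneg (mul_nonneg hu.1 hl)]
  exact mul_le_mul_of_nonneg_right hu.2 hl

lemma abs_integral_sin_mul_sin_mul_abs_rpow_le {p t l : ℝ} (hp : -1 < p) (ht : 0 ≤ t)
    (hl : 0 ≤ l) :
    |∫ u in (0 : ℝ)..t, ∫ v in (0 : ℝ)..t, sin (u * l) * sin (v * l) * |u - v| ^ p| ≤
      (t * l) ^ 2 * (2 * (t ^ (p + 1) / (p + 1))) * t := by
  have hinner : ∀ u ∈ Set.uIoc 0 t,
      ‖∫ v in (0 : ℝ)..t, sin (u * l) * sin (v * l) * |u - v| ^ p‖ ≤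
        (t * l) ^ 2 * (2 * (t ^ (p + 1) / (p + 1))) := by
    intro u hu
    rw [Set.uIoc_of_le ht] at hu
    have hu' := Set.Ioc_subset_Icc_self hu
    have hint : IntervalIntegrable (fun v : ℝ => |u - v| ^ p) volume 0 t := by
      simpa using (intervalIntegrable_abs_rpow hp u (u - t)).comp_sub_left u
    calc ‖∫ v in (0 : ℝ)..t, sin (u * l) * sin (v * l) * |u - v| ^ p‖
        ≤ ∫ v in (0 : ℝ)..t, (t * l) ^ 2 * |u - v| ^ p := by
          refine intervalIntegral.norm_integral_le_of_norm_le ht ?_ (hint.const_mul _)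
          refine Filter.Eventually.of_forall fun v hv => ?_
          rw [norm_mul, norm_mul, norm_eq_abs, norm_eq_abs, norm_eq_abs,
            abs_of_nonneg (rpow_nonneg (abs_nonneg (u - v)) p), sq]
          gcongr
          · exact abs_sin_mul_le hl hu'
          · exact abs_sin_mul_le hl (Set.Ioc_subset_Icc_self hv)
      _ ≤ _ := by
          rw [intervalIntegral.integral_const_mul]
          gcongr
          exact integral_abs_sub_rpow_le hp hu'
  have h := intervalIntegral.norm_integral_le_of_norm_le_const hinner
  rwa [norm_eq_abs, sub_zero, abs_of_nonneg ht] at h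

/-- Proposition 3.7, case `|ξ| ≤ 1`. -/
theorem wave_N_bound_small_freq (H : ℝ) (hH : H ∈ Set.Ioo (1/2 : ℝ) 1) :
    ∃ C : ℝ, 0 < C ∧
      ∀ t l : ℝ, 0 < t → 0 < l → l ≤ 1 →
        (H * (2 * H - 1) / l ^ 2) *
          ∫ u in (0 : ℝ)..t, ∫ v in (0 : ℝ)..t,
            Real.sin (u * l) * Real.sin (v * l) * |u - v| ^ (2 * H - 2) ≤
        C * t ^ (2 * H + 2) * (1 / (1 + l ^ 2)) ^ (H + 1/2) := by
  obtain ⟨hH1, hH2⟩ := hH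
  have hH0 : 0 < H := by linarith
  have hα : 0 < 2 * H - 1 := by linarith
  refine ⟨2 * H * 2 ^ (H + 1/2), by positivity, fun t l ht hl hl1 => ?_⟩
  have hbound := (le_abs_self _).trans
    (abs_integral_sin_mul_sin_mul_abs_rpow_le (p := 2 * H - 2) (by linarith) ht.le hl.le)
  have hweight : 1 ≤ (2 : ℝ) ^ (H + 1/2) * (1 / (1 + l ^ 2)) ^ (H + 1/2) := by
    rw [← mul_rpow (by norm_num) (by positivity)]
    refine one_le_rpow ?_ (by linarith)
    rw [mul_one_div, le_div_iff₀ (by positivity)]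
    nlinarith
  have hpow : t ^ (2 * H + 2) = t ^ (2 * H - 1) * t ^ 3 := by
    rw [← rpow_natCast, ← rpow_add ht]
    norm_num
    ring_nf
  calc _ ≤ (H * (2 * H - 1) / l ^ 2) *
        ((t * l) ^ 2 * (2 * (t ^ (2 * H - 2 + 1) / (2 * H - 2 + 1))) * t) := by
        gcongr
    _ = 2 * H * t ^ (2 * H + 2) * 1 := by
        rw [show 2 * H - 2 + 1 = 2 * H - 1 by ring, hpow]
        have hne := hα.ne'
        generalize 2 * H - 1 = q at hne ⊢
        field_simp
    _ ≤ 2 * H * t ^ (2 * H + 2) * (2 ^ (H + 1/2) * (1 / (1 + l ^ 2)) ^ (H + 1/2)) := by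
        gcongr
    _ = _ := by ring
end

section
/- Let H ∈ (1/2, 1). There exist constants a_H > 0 and b_H > 0, depending only on H, such that for every t > 0 and every λ ≥ 1, N_t(λ) ≤ (a_H + b_H·(t + t³)) · (1/(1+λ²))^{H+1/2}. (Proposition 3.7, case |ξ| ≥ 1) -/
open MeasureTheory Real

/-- A bounded continuous factor against an integrable power singularity at the origin. -/
theorem intervalIntegrable_sin_mul_rpow {r : ℝ} (hr : -1 < r) (φ ω a b : ℝ) :
    IntervalIntegrable (fun s : ℝ => Real.sin (φ + s * ω) * s ^ r) volume a b :=
  (intervalIntegral.intervalIntegrable_rpow' hr).continuousOn_mul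
    (g := fun s => Real.sin (φ + s * ω)) (by fun_prop)

theorem abs_integral_sin_mul_rpow_le_rpow {r : ℝ} (hr : -1 < r) (φ ω : ℝ) {a : ℝ} (ha : 0 ≤ a) :
    |∫ s in (0 : ℝ)..a, Real.sin (φ + s * ω) * s ^ r| ≤ a ^ (r + 1) / (r + 1) := by
  have key : ‖∫ s in (0 : ℝ)..a, Real.sin (φ + s * ω) * s ^ r‖ ≤ ∫ s in (0 : ℝ)..a, s ^ r := by
    refine intervalIntegral.norm_integral_le_of_norm_le ha (.of_forall fun s hs => ?_)
      (intervalIntegral.intervalIntegrable_rpow' hr)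
    rw [Real.norm_eq_abs, abs_mul, abs_of_nonneg (rpow_nonneg hs.1.le r)]
    exact mul_le_of_le_one_left (rpow_nonneg hs.1.le r) (abs_sin_le_one _)
  rwa [integral_rpow (Or.inl hr), zero_rpow (by linarith), sub_zero, Real.norm_eq_abs] at key

/-- Oscillatory integral against a decreasing power, away from the singularity. -/
theorem abs_integral_sin_mul_rpow_le_of_pos {r : ℝ} (hr : r < 0) (φ : ℝ) {ω c a : ℝ}
    (hω : ω ≠ 0) (hc : 0 < c) (hca : c ≤ a) :
    |∫ s in c..a, Real.sin (φ + s * ω) * s ^ r| ≤ 2 * c ^ r / |ω| := by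
  have hpos : ∀ s ∈ Set.uIcc c a, 0 < s := fun s hs => by
    rw [Set.uIcc_of_le hca] at hs; exact hc.trans_le hs.1
  have hω' : 0 < |ω| := abs_pos.2 hω
  have hu : ∀ s ∈ Set.uIcc c a, HasDerivAt (fun s : ℝ => s ^ r) (r * s ^ (r - 1)) s :=
    fun s hs => hasDerivAt_rpow_const (Or.inl (hpos s hs).ne')
  have hv : ∀ s ∈ Set.uIcc c a,
      HasDerivAt (fun s : ℝ => -Real.cos (φ + s * ω) / ω) (Real.sin (φ + s * ω)) s := by
    intro s _
    have h := ((((hasDerivAt_id s).mul_const ω).const_add φ).cos.neg).div_const ω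
    refine h.congr_deriv ?_
    simp [hω]
  have hu' : IntervalIntegrable (fun s : ℝ => r * s ^ (r - 1)) volume c a := by
    apply ContinuousOn.intervalIntegrable
    exact continuousOn_const.mul
      (continuousOn_id.rpow_const fun s hs => Or.inl (hpos s hs).ne')
  have hv' : IntervalIntegrable (fun s : ℝ => Real.sin (φ + s * ω)) volume c a :=
    Continuous.intervalIntegrable (by fun_prop) _ _
  have hparts := intervalIntegral.integral_mul_deriv_eq_deriv_mul hu hv hu' hv'
  have hcos : ∀ s : ℝ, |-Real.cos (φ + s * ω) / ω| ≤ 1 / |ω| := fun s => by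
    rw [abs_div, abs_neg]; gcongr; exact abs_cos_le_one _
  have hrem : ‖∫ s in c..a, r * s ^ (r - 1) * (-Real.cos (φ + s * ω) / ω)‖ ≤
      ∫ s in c..a, -(r * s ^ (r - 1)) * (1 / |ω|) := by
    refine intervalIntegral.norm_integral_le_of_norm_le hca (.of_forall fun s hs => ?_)
      (hu'.neg.mul_const _)
    have hs0 : 0 ≤ s ^ (r - 1) := rpow_nonneg (hc.trans hs.1).le _
    rw [Real.norm_eq_abs, abs_mul, abs_of_nonpos (mul_nonpos_of_nonpos_of_nonneg hr.le hs0)]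
    exact mul_le_mul_of_nonneg_left (hcos s)
      (neg_nonneg.2 (mul_nonpos_of_nonpos_of_nonneg hr.le hs0))
  rw [intervalIntegral.integral_mul_const, intervalIntegral.integral_neg,
    intervalIntegral.integral_eq_sub_of_hasDerivAt hu hu', Real.norm_eq_abs] at hrem
  have hbd : ∀ s : ℝ, 0 < s → |s ^ r * (-Real.cos (φ + s * ω) / ω)| ≤ s ^ r * (1 / |ω|) :=
    fun s hs => by
      rw [abs_mul, abs_of_nonneg (rpow_nonneg hs.le r)]
      exact mul_le_mul_of_nonneg_left (hcos s) (rpow_nonneg hs.le r)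
  have h₁ := hbd a (hc.trans_le hca)
  have h₂ := hbd c hc
  simp only [mul_comm (Real.sin _)]
  rw [hparts]
  calc _ ≤ a ^ r * (1 / |ω|) + c ^ r * (1 / |ω|) + -(a ^ r - c ^ r) * (1 / |ω|) :=
        (abs_sub _ _).trans (add_le_add ((abs_sub _ _).trans (add_le_add h₁ h₂)) hrem)
    _ = 2 * c ^ r / |ω| := by ring

/-- Uniform bound for the oscillatory integral with a power singularity at an endpoint. -/
theorem abs_integral_sin_mul_rpow_le {r : ℝ} (hr : -1 < r) (hr0 : r < 0) (φ : ℝ) {ω a : ℝ}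
    (hω : ω ≠ 0) (ha : 0 ≤ a) :
    |∫ s in (0 : ℝ)..a, Real.sin (φ + s * ω) * s ^ r| ≤
      (1 / (r + 1) + 2) * |ω| ^ (-1 - r) := by
  have hω' : 0 < |ω| := abs_pos.2 hω
  have hr1 : 0 < r + 1 := by linarith
  have hinv : (|ω|⁻¹) ^ (r + 1) = |ω| ^ (-1 - r) := by
    rw [inv_rpow hω'.le, ← rpow_neg hω'.le]; congr 1; ring
  have hp : 0 < |ω| ^ (-1 - r) := rpow_pos_of_pos hω' _
  have hnear : ∀ c : ℝ, 0 ≤ c → c ≤ |ω|⁻¹ →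
      |∫ s in (0 : ℝ)..c, Real.sin (φ + s * ω) * s ^ r| ≤ 1 / (r + 1) * |ω| ^ (-1 - r) := by
    intro c hc hcω
    refine (abs_integral_sin_mul_rpow_le_rpow hr φ ω hc).trans ?_
    rw [← hinv, one_div_mul_eq_div]
    gcongr
  rcases le_total a |ω|⁻¹ with h | h
  · linarith [hnear a ha h]
  · have hfar := abs_integral_sin_mul_rpow_le_of_pos hr0 φ hω (inv_pos.2 hω') h
    have heq : 2 * (|ω|⁻¹) ^ r / |ω| = 2 * |ω| ^ (-1 - r) := by
      rw [← hinv, rpow_add_one (inv_pos.2 hω').ne']; ring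
    rw [← intervalIntegral.integral_add_adjacent_intervals
      (intervalIntegrable_sin_mul_rpow hr φ ω 0 |ω|⁻¹)
      (intervalIntegrable_sin_mul_rpow hr φ ω |ω|⁻¹ a)]
    refine (abs_add_le _ _).trans ?_
    linarith [hnear _ (inv_pos.2 hω').le le_rfl]

theorem abs_integral_sin_mul_abs_sub_rpow_le {r : ℝ} (hr : -1 < r) (hr0 : r < 0) {l u t : ℝ}
    (hl : 0 < l) (hu : 0 ≤ u) (hut : u ≤ t) :
    |∫ v in (0 : ℝ)..t, Real.sin (v * l) * |u - v| ^ r| ≤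
      2 * (1 / (r + 1) + 2) * l ^ (-1 - r) := by
  have eqL : Set.EqOn (fun v : ℝ => Real.sin (u * l + (u - v) * (-l)) * (u - v) ^ r)
      (fun v => Real.sin (v * l) * |u - v| ^ r) (Set.uIcc 0 u) := by
    intro v hv
    rw [Set.uIcc_of_le hu] at hv
    simp only [abs_of_nonneg (sub_nonneg.2 hv.2)]
    ring_nf
  have eqR : Set.EqOn (fun v : ℝ => Real.sin (u * l + (v - u) * l) * (v - u) ^ r)
      (fun v => Real.sin (v * l) * |u - v| ^ r) (Set.uIcc u t) := by
    intro v hv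
    rw [Set.uIcc_of_le hut] at hv
    simp only [abs_sub_comm u v, abs_of_nonneg (sub_nonneg.2 hv.1)]
    ring_nf
  have intL : IntervalIntegrable (fun v => Real.sin (v * l) * |u - v| ^ r) volume 0 u := by
    have h := (intervalIntegrable_sin_mul_rpow hr (u * l) (-l) u 0).comp_sub_left u
    rw [sub_self, sub_zero] at h
    exact h.congr (eqL.mono Set.uIoc_subset_uIcc)
  have intR : IntervalIntegrable (fun v => Real.sin (v * l) * |u - v| ^ r) volume u t := by
    have h := (intervalIntegrable_sin_mul_rpow hr (u * l) l 0 (t - u)).comp_sub_right u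
    rw [zero_add, sub_add_cancel] at h
    exact h.congr (eqR.mono Set.uIoc_subset_uIcc)
  have hL := abs_integral_sin_mul_rpow_le hr hr0 (u * l) (neg_ne_zero.2 hl.ne') hu
  have hR := abs_integral_sin_mul_rpow_le hr hr0 (u * l) hl.ne' (sub_nonneg.2 hut)
  rw [abs_neg, abs_of_pos hl] at hL
  rw [abs_of_pos hl] at hR
  rw [← intervalIntegral.integral_add_adjacent_intervals intL intR,
    ← intervalIntegral.integral_congr eqL, ← intervalIntegral.integral_congr eqR,
    intervalIntegral.integral_comp_sub_left
      (fun s : ℝ => Real.sin (u * l + s * (-l)) * s ^ r) u,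
    intervalIntegral.integral_comp_sub_right
      (fun s : ℝ => Real.sin (u * l + s * l) * s ^ r) u, sub_self, sub_zero]
  refine (abs_add_le _ _).trans ?_
  linarith

/-- Proposition 3.7, case `|ξ| ≥ 1`. -/
theorem wave_N_bound_large_freq (H : ℝ) (hH : H ∈ Set.Ioo (1/2 : ℝ) 1) :
    ∃ a b : ℝ, 0 < a ∧ 0 < b ∧
      ∀ t l : ℝ, 0 < t → 1 ≤ l →
        (H * (2 * H - 1) / l ^ 2) *
          ∫ u in (0 : ℝ)..t, ∫ v in (0 : ℝ)..t,
            Real.sin (u * l) * Real.sin (v * l) * |u - v| ^ (2 * H - 2) ≤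
        (a + b * (t + t ^ 3)) * (1 / (1 + l ^ 2)) ^ (H + 1/2) := by
  obtain ⟨h1, h2⟩ := hH
  have hr : -1 < 2 * H - 2 := by linarith
  have hr0 : 2 * H - 2 < 0 := by linarith
  have hα : 0 < H * (2 * H - 1) := mul_pos (by linarith) (by linarith)
  set C : ℝ := 2 * (1 / (2 * H - 2 + 1) + 2)
  have hCpos : 0 < C := by
    have : 0 < 2 * H - 2 + 1 := by linarith
    positivity
  refine ⟨1, H * (2 * H - 1) * C * 2 ^ (H + 1/2), one_pos, by positivity, fun t l ht hl => ?_⟩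
  have hl0 : 0 < l := by linarith
  have hI : ‖∫ u in (0 : ℝ)..t, ∫ v in (0 : ℝ)..t,
      Real.sin (u * l) * Real.sin (v * l) * |u - v| ^ (2 * H - 2)‖ ≤
      C * l ^ (-1 - (2 * H - 2)) * |t - 0| := by
    refine intervalIntegral.norm_integral_le_of_norm_le_const fun u hu => ?_
    rw [Set.uIoc_of_le ht.le] at hu
    simp only [mul_assoc (Real.sin (u * l))]
    rw [intervalIntegral.integral_const_mul, Real.norm_eq_abs, abs_mul]
    exact (mul_le_of_le_one_left (abs_nonneg _) (abs_sin_le_one _)).trans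
      (abs_integral_sin_mul_abs_sub_rpow_le hr hr0 hl0 hu.1.le hu.2)
  rw [sub_zero, abs_of_pos ht] at hI
  have hfreq : l ^ (-1 - (2 * H - 2)) / l ^ 2 ≤
      2 ^ (H + 1/2) * (1 / (1 + l ^ 2)) ^ (H + 1/2) := by
    rw [← mul_rpow (by norm_num) (by positivity)]
    have e : l ^ (-1 - (2 * H - 2)) / l ^ 2 = (1 / l ^ 2) ^ (H + 1/2) := by
      rw [one_div, inv_rpow (by positivity), ← rpow_natCast l 2, ← rpow_mul hl0.le,
        ← rpow_neg hl0.le, ← rpow_sub hl0]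
      congr 1
      push_cast
      ring
    rw [e]
    refine rpow_le_rpow (by positivity) ?_ (by linarith)
    rw [mul_one_div, div_le_div_iff₀ (by positivity) (by positivity)]
    nlinarith
  calc _ ≤ (H * (2 * H - 1) / l ^ 2) * (C * l ^ (-1 - (2 * H - 2)) * t) :=
        mul_le_mul_of_nonneg_left ((le_abs_self _).trans hI) (by positivity)
    _ = H * (2 * H - 1) * C * t * (l ^ (-1 - (2 * H - 2)) / l ^ 2) := by ring
    _ ≤ H * (2 * H - 1) * C * t * (2 ^ (H + 1/2) * (1 / (1 + l ^ 2)) ^ (H + 1/2)) :=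
        mul_le_mul_of_nonneg_left hfreq (by positivity)
    _ = (H * (2 * H - 1) * C * 2 ^ (H + 1/2) * t) * (1 / (1 + l ^ 2)) ^ (H + 1/2) := by ring
    _ ≤ _ := by
        refine mul_le_mul_of_nonneg_right ?_ (by positivity)
        have : 0 ≤ H * (2 * H - 1) * C * 2 ^ (H + 1/2) * t ^ 3 := by positivity
        linarith
end

section
/- Let H ∈ (1/2, 1) and let μ be a nonnegative Borel measure on ℝ^d such that ∫_{{|ξ| ≥ 1}} |ξ|^{−2l} μ(dξ) < ∞ for some integer l ≥ 1. If for some t > 0 it holds that α_H · ∫_{{|ξ| ≥ 1}} |ξ|^{−2} · (∫_0^t ∫_0^t sin(u|ξ|)·sin(v|ξ|)·|u−v|^{2H−2} du dv) μ(dξ) < ∞, then ∫_{{|ξ| ≥ 1}} |ξ|^{−(2H+1)} μ(dξ) < ∞. (Proposition 3.8 (b)) -/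
open MeasureTheory Real

lemma one_sub_cos_le_self {x : ℝ} (hx : 0 ≤ x) : 1 - cos x ≤ x := by
  rcases le_total 2 x with h | h
  · linarith [neg_one_le_cos x]
  · nlinarith [one_sub_sq_div_two_le_cos (x := x)]

lemma integrableOn_rpow_mul_one_sub_cos {p : ℝ} (hp : 1 < p) (hp' : p < 3) :
    IntegrableOn (fun w : ℝ => w ^ (-p) * (1 - cos w)) (Set.Ioi 0) := by
  have hmeas : Measurable (fun w : ℝ => w ^ (-p) * (1 - cos w)) := by fun_prop
  rw [← Set.Ioc_union_Ioi_eq_Ioi zero_le_one]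
  refine IntegrableOn.union ?_ ?_
  · have h : IntegrableOn (fun w : ℝ => w ^ (2 - p)) (Set.Ioc 0 1) :=
      (intervalIntegrable_iff_integrableOn_Ioc_of_le zero_le_one).1
        (intervalIntegral.intervalIntegrable_rpow' (by linarith))
    refine Integrable.mono' h hmeas.aestronglyMeasurable ?_
    filter_upwards [ae_restrict_mem measurableSet_Ioc] with w hw
    have hw0 := hw.1
    have hq : w ^ (2 - p) = w ^ (-p) * w ^ 2 := by
      rw [← rpow_natCast, ← rpow_add hw0]; congr 1; push_cast; ring
    rw [norm_of_nonneg (mul_nonneg (rpow_nonneg hw0.le _) (by linarith [cos_le_one w])), hq]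
    gcongr
    nlinarith [one_sub_sq_div_two_le_cos (x := w)]
  · have h : IntegrableOn (fun w : ℝ => w ^ (-p) * 2) (Set.Ioi 1) :=
      (integrableOn_Ioi_rpow_of_lt (by linarith) one_pos).mul_const 2
    refine Integrable.mono' h hmeas.aestronglyMeasurable ?_
    filter_upwards [ae_restrict_mem measurableSet_Ioi] with w hw
    have hw0 : (0 : ℝ) < w := one_pos.trans hw
    rw [norm_of_nonneg (mul_nonneg (rpow_nonneg hw0.le _) (by linarith [cos_le_one w]))]
    gcongr
    linarith [neg_one_le_cos w]

lemma integral_Ioi_rpow_mul_one_sub_cos_nonneg (p : ℝ) {a : ℝ} (ha : 0 ≤ a) :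
    0 ≤ ∫ w in Set.Ioi a, w ^ (-p) * (1 - cos w) :=
  setIntegral_nonneg measurableSet_Ioi fun w hw =>
    mul_nonneg (rpow_nonneg (ha.trans hw.le) _) (by linarith [cos_le_one w])

lemma integral_Ioi_rpow_mul_one_sub_cos_pos {p : ℝ} (hp : 1 < p) (hp' : p < 3) :
    0 < ∫ w in Set.Ioi (0 : ℝ), w ^ (-p) * (1 - cos w) := by
  have hint := integrableOn_rpow_mul_one_sub_cos hp hp'
  rw [← intervalIntegral.integral_interval_add_Ioi hint
    (hint.mono_set (Set.Ioi_subset_Ioi zero_le_one))]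
  refine add_pos_of_pos_of_nonneg (intervalIntegral.intervalIntegral_pos_of_pos_on ?_ ?_ one_pos)
    (integral_Ioi_rpow_mul_one_sub_cos_nonneg p zero_le_one)
  · exact (intervalIntegrable_iff_integrableOn_Ioc_of_le zero_le_one).2
      (hint.mono_set Set.Ioc_subset_Ioi_self)
  · intro w hw
    refine mul_pos (rpow_pos_of_pos hw.1 _) ?_
    have := cos_lt_cos_of_nonneg_of_le_pi le_rfl (by linarith [hw.2, pi_gt_three]) hw.1
    rw [cos_zero] at this
    linarith

/-- Tail bound using `1 - cos w ≤ 2`. -/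
lemma integral_Ioi_rpow_mul_one_sub_cos_le_two {b u : ℝ} (hb : 0 < b) (hb' : b < 2) (hu : 0 < u) :
    b * ∫ w in Set.Ioi u, w ^ (-(b + 1)) * (1 - cos w) ≤ 2 * u ^ (-b) := by
  have h : ∫ w in Set.Ioi u, w ^ (-(b + 1)) * (1 - cos w) ≤
      ∫ w in Set.Ioi u, w ^ (-(b + 1)) * 2 := by
    refine setIntegral_mono_on
      ((integrableOn_rpow_mul_one_sub_cos (by linarith) (by linarith)).mono_set
        (Set.Ioi_subset_Ioi hu.le))
      ((integrableOn_Ioi_rpow_of_lt (by linarith) hu).mul_const 2) measurableSet_Ioi ?_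
    intro w hw
    have := rpow_nonneg (hu.le.trans (le_of_lt hw)) (-(b + 1))
    gcongr
    linarith [neg_one_le_cos w]
  rw [integral_mul_const, integral_Ioi_rpow_of_lt (by linarith) hu] at h
  calc _ ≤ b * (-u ^ (-(b + 1) + 1) / (-(b + 1) + 1) * 2) := by gcongr
    _ = 2 * u ^ (-b) := by
      rw [show -(b + 1) + 1 = -b by ring]; field_simp

/-- Tail bound using `1 - cos w ≤ w`. -/
lemma integral_Ioi_rpow_mul_one_sub_cos_le_self {b u : ℝ} (hb : 0 < b) (hb' : b < 1)
    (hu : 0 < u) :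
    b * ∫ w in Set.Ioi u, w ^ (-(b + 2)) * (1 - cos w) ≤ u ^ (-b) := by
  have h : ∫ w in Set.Ioi u, w ^ (-(b + 2)) * (1 - cos w) ≤
      ∫ w in Set.Ioi u, w ^ (-(b + 1)) := by
    refine setIntegral_mono_on
      ((integrableOn_rpow_mul_one_sub_cos (by linarith) (by linarith)).mono_set
        (Set.Ioi_subset_Ioi hu.le))
      (integrableOn_Ioi_rpow_of_lt (by linarith) hu) measurableSet_Ioi ?_
    intro w hw
    have hw0 : 0 < w := hu.trans hw
    have hq : w ^ (-(b + 1)) = w ^ (-(b + 2)) * w := by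
      rw [← rpow_add_one hw0.ne']; congr 1; ring
    rw [hq]
    gcongr
    exact one_sub_cos_le_self hw0.le
  rw [integral_Ioi_rpow_of_lt (by linarith) hu] at h
  calc _ ≤ b * (-u ^ (-(b + 1) + 1) / (-(b + 1) + 1)) := by gcongr
    _ = u ^ (-b) := by
      rw [show -(b + 1) + 1 = -b by ring]; field_simp

lemma intervalIntegrable_rpow_mul_one_sub_cos {p u : ℝ} (hp : 1 < p) (hp' : p < 3)
    (hu : 0 ≤ u) : IntervalIntegrable (fun w : ℝ => w ^ (-p) * (1 - cos w)) volume 0 u :=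
  (intervalIntegrable_iff_integrableOn_Ioc_of_le hu).2
    ((integrableOn_rpow_mul_one_sub_cos hp hp').mono_set Set.Ioc_subset_Ioi_self)

lemma intervalIntegrable_rpow_mul_cos {b : ℝ} (hb : b < 1) (x y : ℝ) :
    IntervalIntegrable (fun w : ℝ => w ^ (-b) * cos w) volume x y :=
  (intervalIntegral.intervalIntegrable_rpow' (by linarith)).mul_continuousOn
    continuous_cos.continuousOn

lemma intervalIntegrable_rpow_mul_sin {b : ℝ} (hb : b < 1) (x y : ℝ) :
    IntervalIntegrable (fun w : ℝ => w ^ (-b) * sin w) volume x y :=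
  (intervalIntegral.intervalIntegrable_rpow' (by linarith)).mul_continuousOn
    continuous_sin.continuousOn

/-- A function dominated by `K * x ^ s` with `s > 0`, continuous on `(0, ∞)` and vanishing at `0`,
is continuous on `[0, u]`. -/
lemma continuousOn_Icc_of_abs_le_rpow {f : ℝ → ℝ} {K s u : ℝ} (hs : 0 < s) (h0 : f 0 = 0)
    (hf : ContinuousOn f (Set.Ioi 0)) (hK : ∀ x, 0 < x → |f x| ≤ K * x ^ s) :
    ContinuousOn f (Set.Icc 0 u) := by
  intro x hx
  rcases hx.1.eq_or_lt with rfl | hx0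
  · have hlim : Filter.Tendsto (fun x : ℝ => K * x ^ s) (nhdsWithin 0 (Set.Icc 0 u)) (nhds 0) := by
      have hc : ContinuousAt (fun x : ℝ => K * x ^ s) 0 :=
        continuousAt_const.mul (continuousAt_rpow_const 0 s (Or.inr hs.le))
      simpa [ContinuousAt, zero_rpow hs.ne'] using hc.tendsto.mono_left nhdsWithin_le_nhds
    rw [ContinuousWithinAt, h0]
    refine squeeze_zero_norm' ?_ hlim
    filter_upwards [self_mem_nhdsWithin] with y hy
    rcases hy.1.eq_or_lt with rfl | hy0
    · simp [h0, zero_rpow hs.ne']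
    · exact hK y hy0
  · exact (hf.continuousAt (Ioi_mem_nhds hx0)).continuousWithinAt

lemma integral_rpow_mul_sin {b u : ℝ} (hb : 0 < b) (hb' : b < 1) (hu : 0 ≤ u) :
    ∫ w in (0 : ℝ)..u, w ^ (-b) * sin w =
      u ^ (-b) * (1 - cos u) + b * ∫ w in (0 : ℝ)..u, w ^ (-(b + 1)) * (1 - cos w) := by
  have hI := (intervalIntegrable_rpow_mul_one_sub_cos (p := b + 1) (by linarith) (by linarith)
    hu).const_mul b
  have hS := intervalIntegrable_rpow_mul_sin hb' 0 u
  have key := intervalIntegral.integral_eq_sub_of_hasDerivAt_of_le hu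
    (f := fun w => w ^ (-b) * (1 - cos w))
    (f' := fun w => w ^ (-b) * sin w - b * (w ^ (-(b + 1)) * (1 - cos w))) ?_ ?_ (hS.sub hI)
  · rw [intervalIntegral.integral_sub hS hI, intervalIntegral.integral_const_mul] at key
    simp only [cos_zero, sub_self, mul_zero, sub_zero] at key
    linarith
  · refine continuousOn_Icc_of_abs_le_rpow (K := 1) (s := 1 - b) (by linarith) (by simp) ?_ ?_
    · intro x hx
      exact ((continuousAt_rpow_const x _ (Or.inl (ne_of_gt hx))).mul
        (by fun_prop)).continuousWithinAt
    · intro x hx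
      rw [abs_of_nonneg (mul_nonneg (rpow_nonneg hx.le _) (by linarith [cos_le_one x])), one_mul,
        show 1 - b = -b + 1 by ring, rpow_add_one hx.ne']
      gcongr
      exact one_sub_cos_le_self hx.le
  · intro x hx
    have h1 := hasDerivAt_rpow_const (x := x) (p := -b) (Or.inl hx.1.ne')
    have h2 := (hasDerivAt_cos x).const_sub 1
    refine (h1.mul h2).congr_deriv ?_
    rw [show -b - 1 = -(b + 1) by ring]
    ring

lemma integral_rpow_mul_cos {b u : ℝ} (hb : 0 < b) (hb' : b < 1) (hu : 0 ≤ u) :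
    ∫ w in (0 : ℝ)..u, w ^ (-b) * cos w =
      u ^ (-b) * sin u + b * (u ^ (-(b + 1)) * (1 - cos u)) +
        b * (b + 1) * ∫ w in (0 : ℝ)..u, w ^ (-(b + 2)) * (1 - cos w) := by
  have hI := (intervalIntegrable_rpow_mul_one_sub_cos (p := b + 2) (by linarith) (by linarith)
    hu).const_mul (b * (b + 1))
  have hC := intervalIntegrable_rpow_mul_cos hb' 0 u
  have key := intervalIntegral.integral_eq_sub_of_hasDerivAt_of_le hu
    (f := fun w => w ^ (-b) * sin w + b * (w ^ (-(b + 1)) * (1 - cos w)))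
    (f' := fun w => w ^ (-b) * cos w - b * (b + 1) * (w ^ (-(b + 2)) * (1 - cos w)))
    ?_ ?_ (hC.sub hI)
  · rw [intervalIntegral.integral_sub hC hI, intervalIntegral.integral_const_mul] at key
    simp only [cos_zero, sin_zero, sub_self, mul_zero, sub_zero, add_zero] at key
    linarith
  · refine ContinuousOn.add ?_ (ContinuousOn.mul continuousOn_const ?_)
    · refine continuousOn_Icc_of_abs_le_rpow (K := 1) (s := 1 - b) (by linarith) (by simp) ?_ ?_
      · intro x hx
        exact ((continuousAt_rpow_const x _ (Or.inl (ne_of_gt hx))).mul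
          (by fun_prop)).continuousWithinAt
      · intro x hx
        rw [abs_mul, abs_of_nonneg (rpow_nonneg hx.le _), one_mul,
          show 1 - b = -b + 1 by ring, rpow_add_one hx.ne']
        gcongr
        exact abs_sin_le_abs.trans_eq (abs_of_pos hx)
    · refine continuousOn_Icc_of_abs_le_rpow (K := 1) (s := 1 - b) (by linarith) (by simp) ?_ ?_
      · intro x hx
        exact ((continuousAt_rpow_const x _ (Or.inl (ne_of_gt hx))).mul
          (by fun_prop)).continuousWithinAt
      · intro x hx
        rw [abs_of_nonneg (mul_nonneg (rpow_nonneg hx.le _) (by linarith [cos_le_one x])), one_mul,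
          show 1 - b = -(b + 1) + (2 : ℕ) by push_cast; ring, rpow_add_natCast hx.ne']
        gcongr
        nlinarith [one_sub_sq_div_two_le_cos (x := x)]
  · intro x hx
    have h1 := hasDerivAt_rpow_const (x := x) (p := -b) (Or.inl hx.1.ne')
    have h1' := hasDerivAt_rpow_const (x := x) (p := -(b + 1)) (Or.inl hx.1.ne')
    have h2 := (hasDerivAt_cos x).const_sub 1
    refine ((h1.mul (hasDerivAt_sin x)).add ((h1'.mul h2).const_mul b)).congr_deriv ?_
    rw [show -b - 1 = -(b + 1) by ring, show -(b + 1) - 1 = -(b + 2) by ring]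
    ring

lemma exists_abs_integral_rpow_mul_sin_sub_le {b : ℝ} (hb : 0 < b) (hb' : b < 1) :
    ∃ s : ℝ, ∀ u : ℝ, 0 < u →
      |(∫ w in (0 : ℝ)..u, w ^ (-b) * sin w) - s| ≤ 3 * u ^ (-b) := by
  refine ⟨b * ∫ w in Set.Ioi (0 : ℝ), w ^ (-(b + 1)) * (1 - cos w), fun u hu => ?_⟩
  have hint := integrableOn_rpow_mul_one_sub_cos (p := b + 1) (by linarith) (by linarith)
  rw [integral_rpow_mul_sin hb hb' hu.le, ← intervalIntegral.integral_interval_add_Ioi hint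
    (hint.mono_set (Set.Ioi_subset_Ioi hu.le))]
  have h1 := integral_Ioi_rpow_mul_one_sub_cos_le_two hb (by linarith) hu
  have h2 := mul_nonneg hb.le (integral_Ioi_rpow_mul_one_sub_cos_nonneg (b + 1) hu.le)
  have h3 := rpow_nonneg hu.le (-b)
  rw [abs_le]
  constructor <;> nlinarith [cos_le_one u, neg_one_le_cos u]

lemma exists_pos_abs_integral_rpow_mul_cos_sub_le {b : ℝ} (hb : 0 < b) (hb' : b < 1) :
    ∃ c : ℝ, 0 < c ∧ ∀ u : ℝ, 0 < u →
      |(∫ w in (0 : ℝ)..u, w ^ (-b) * cos w) - c| ≤ 3 * u ^ (-b) := by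
  refine ⟨b * (b + 1) * ∫ w in Set.Ioi (0 : ℝ), w ^ (-(b + 2)) * (1 - cos w),
    mul_pos (by positivity) (integral_Ioi_rpow_mul_one_sub_cos_pos (by linarith) (by linarith)),
    fun u hu => ?_⟩
  have hint := integrableOn_rpow_mul_one_sub_cos (p := b + 2) (by linarith) (by linarith)
  rw [integral_rpow_mul_cos hb hb' hu.le, ← intervalIntegral.integral_interval_add_Ioi hint
    (hint.mono_set (Set.Ioi_subset_Ioi hu.le))]
  have h1 := integral_Ioi_rpow_mul_one_sub_cos_le_self hb hb' hu
  have h2 := mul_nonneg hb.le (integral_Ioi_rpow_mul_one_sub_cos_nonneg (b + 2) hu.le)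
  have h3 := rpow_nonneg hu.le (-b)
  have h4 : u ^ (-(b + 1)) * (1 - cos u) ≤ u ^ (-b) := by
    rw [show -b = -(b + 1) + 1 by ring, rpow_add_one hu.ne']
    gcongr
    exact one_sub_cos_le_self hu.le
  have h5 : 0 ≤ u ^ (-(b + 1)) * (1 - cos u) :=
    mul_nonneg (rpow_nonneg hu.le _) (by linarith [cos_le_one u])
  have h6 : |u ^ (-b) * sin u| ≤ u ^ (-b) := by
    rw [abs_mul, abs_of_nonneg h3]
    exact mul_le_of_le_one_right h3 (abs_sin_le_one u)
  rw [abs_le] at h6 ⊢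
  constructor <;> nlinarith

lemma intervalIntegrable_sin_mul_abs_sub_rpow {b : ℝ} (hb' : b < 1) (u x y : ℝ) :
    IntervalIntegrable (fun v : ℝ => sin v * |u - v| ^ (-b)) volume x y := by
  have h0 : IntervalIntegrable (fun w : ℝ => |w| ^ (-b)) volume (u - x) (u - y) := by
    refine intervalIntegrable_of_even (fun w => by rw [abs_neg]) fun w hw => ?_
    refine (intervalIntegral.intervalIntegrable_rpow' (r := -b) (by linarith)).congr fun v hv => ?_
    rw [Set.uIoc_of_le hw.le] at hv
    simp only [abs_of_pos hv.1]
  have h1 := h0.comp_sub_left u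
  simp only [sub_sub_cancel] at h1
  exact h1.continuousOn_mul continuous_sin.continuousOn

/-- The inner integral of the sine energy, through the incomplete cosine and sine integrals. -/
lemma integral_sin_mul_abs_sub_rpow {b T u : ℝ} (hb' : b < 1) (hu : u ∈ Set.Icc 0 T) :
    ∫ v in (0 : ℝ)..T, sin v * |u - v| ^ (-b) =
      sin u * ((∫ w in (0 : ℝ)..u, w ^ (-b) * cos w) + ∫ w in (0 : ℝ)..(T - u), w ^ (-b) * cos w) +
      cos u * ((∫ w in (0 : ℝ)..(T - u), w ^ (-b) * sin w) -
        ∫ w in (0 : ℝ)..u, w ^ (-b) * sin w) := by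
  have hC := intervalIntegrable_rpow_mul_cos hb'
  have hS := intervalIntegrable_rpow_mul_sin hb'
  have h1 : ∫ v in (0 : ℝ)..u, sin v * |u - v| ^ (-b) =
      sin u * (∫ w in (0 : ℝ)..u, w ^ (-b) * cos w) -
        cos u * ∫ w in (0 : ℝ)..u, w ^ (-b) * sin w := by
    have h := intervalIntegral.integral_comp_sub_left (a := 0) (b := u)
      (fun w => sin (u - w) * |w| ^ (-b)) u
    simp only [sub_sub_cancel, sub_self, sub_zero] at h
    rw [h, ← intervalIntegral.integral_const_mul, ← intervalIntegral.integral_const_mul,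
      ← intervalIntegral.integral_sub ((hC 0 u).const_mul _) ((hS 0 u).const_mul _)]
    refine intervalIntegral.integral_congr fun w hw => ?_
    rw [Set.uIcc_of_le hu.1] at hw
    simp only [abs_of_nonneg hw.1, sin_sub]
    ring
  have h2 : ∫ v in u..T, sin v * |u - v| ^ (-b) =
      sin u * (∫ w in (0 : ℝ)..(T - u), w ^ (-b) * cos w) +
        cos u * ∫ w in (0 : ℝ)..(T - u), w ^ (-b) * sin w := by
    have h := intervalIntegral.integral_comp_sub_right (a := u) (b := T)
      (fun w => sin (u + w) * |w| ^ (-b)) u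
    simp only [add_sub_cancel, sub_self] at h
    simp only [abs_sub_comm u]
    rw [h, ← intervalIntegral.integral_const_mul, ← intervalIntegral.integral_const_mul,
      ← intervalIntegral.integral_add ((hC 0 _).const_mul _) ((hS 0 _).const_mul _)]
    refine intervalIntegral.integral_congr fun w hw => ?_
    rw [Set.uIcc_of_le (sub_nonneg.2 hu.2)] at hw
    simp only [abs_of_nonneg hw.1, sin_add]
    ring
  rw [← intervalIntegral.integral_add_adjacent_intervals
    (intervalIntegrable_sin_mul_abs_sub_rpow hb' u 0 u)
    (intervalIntegrable_sin_mul_abs_sub_rpow hb' u u T), h1, h2]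
  ring

/-- The sine energy on `[0, T]²` of the kernel `|u - v| ^ (-b)` grows at least linearly. -/
lemma exists_pos_le_integral_sin_mul_sin_mul_abs_sub_rpow {b : ℝ} (hb : 0 < b) (hb' : b < 1) :
    ∃ c : ℝ, 0 < c ∧ ∀ T : ℝ, 0 ≤ T → c * (T - 1) - 12 / (1 - b) * T ^ (1 - b) ≤
      ∫ u in (0 : ℝ)..T, ∫ v in (0 : ℝ)..T, sin u * sin v * |u - v| ^ (-b) := by
  obtain ⟨c, hc, hC⟩ := exists_pos_abs_integral_rpow_mul_cos_sub_le hb hb'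
  obtain ⟨s, hS⟩ := exists_abs_integral_rpow_mul_sin_sub_le hb hb'
  refine ⟨c, hc, fun T hT => ?_⟩
  set C : ℝ → ℝ := fun u => ∫ w in (0 : ℝ)..u, w ^ (-b) * cos w
  set S : ℝ → ℝ := fun u => ∫ w in (0 : ℝ)..u, w ^ (-b) * sin w
  have hCc : Continuous C :=
    intervalIntegral.continuous_primitive (intervalIntegrable_rpow_mul_cos hb') 0
  have hSc : Continuous S :=
    intervalIntegral.continuous_primitive (intervalIntegrable_rpow_mul_sin hb') 0
  have heq : ∫ u in (0 : ℝ)..T, ∫ v in (0 : ℝ)..T, sin u * sin v * |u - v| ^ (-b) =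
      ∫ u in (0 : ℝ)..T, (sin u * (sin u * (C u + C (T - u)) + cos u * (S (T - u) - S u))) := by
    refine intervalIntegral.integral_congr fun u hu => ?_
    rw [Set.uIcc_of_le hT] at hu
    simp only [mul_assoc]
    rw [intervalIntegral.integral_const_mul, integral_sin_mul_abs_sub_rpow hb' hu]
  have hr : IntervalIntegrable (fun u : ℝ => u ^ (-b)) volume 0 T :=
    intervalIntegral.intervalIntegrable_rpow' (by linarith)
  have hr' : IntervalIntegrable (fun u : ℝ => (T - u) ^ (-b)) volume 0 T := by
    simpa using (hr.comp_sub_left T).symm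
  have hsq : IntervalIntegrable (fun u : ℝ => 2 * c * sin u ^ 2) volume 0 T :=
    Continuous.intervalIntegrable (by fun_prop) _ _
  have hval : ∫ u in (0 : ℝ)..T, (2 * c * sin u ^ 2 - 6 * (u ^ (-b) + (T - u) ^ (-b))) =
      c * (T - sin T * cos T) - 12 / (1 - b) * T ^ (1 - b) := by
    have h := intervalIntegral.integral_comp_sub_left (a := 0) (b := T) (fun w => w ^ (-b)) T
    simp only [sub_self, sub_zero] at h
    have hr0 : ∫ u in (0 : ℝ)..T, u ^ (-b) = T ^ (1 - b) / (1 - b) := by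
      rw [integral_rpow (Or.inl (by linarith)), show -b + 1 = 1 - b by ring,
        zero_rpow (by linarith), sub_zero]
    rw [intervalIntegral.integral_sub hsq ((hr.add hr').const_mul 6),
      intervalIntegral.integral_const_mul, intervalIntegral.integral_const_mul,
      intervalIntegral.integral_add hr hr', h, hr0, integral_sin_sq, sin_zero]
    ring
  have hsc : sin T * cos T ≤ 1 := by nlinarith [sin_sq_add_cos_sq T, sq_nonneg (sin T - cos T)]
  calc c * (T - 1) - 12 / (1 - b) * T ^ (1 - b)
      ≤ c * (T - sin T * cos T) - 12 / (1 - b) * T ^ (1 - b) := by gcongr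
    _ ≤ _ := by
      rw [heq, ← hval]
      refine intervalIntegral.integral_mono_on_of_le_Ioo hT (hsq.sub ((hr.add hr').const_mul 6))
        (Continuous.intervalIntegrable (by fun_prop) _ _) fun u hu => ?_
      have hu1 : 0 < T - u := sub_pos.2 hu.2
      have a1 := abs_le.1 (hC u hu.1)
      have a2 := abs_le.1 (hC _ hu1)
      have a3 := abs_le.1 (hS u hu.1)
      have a4 := abs_le.1 (hS _ hu1)
      have e1 := rpow_nonneg hu.1.le (-b)
      have e2 := rpow_nonneg hu1.le (-b)
      have b1 : sin u ^ 2 * (2 * c - (C u + C (T - u))) ≤ 3 * (u ^ (-b) + (T - u) ^ (-b)) := by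
        have hle : 2 * c - (C u + C (T - u)) ≤ 3 * (u ^ (-b) + (T - u) ^ (-b)) := by
          linarith [a1.1, a2.1]
        calc _ ≤ sin u ^ 2 * (3 * (u ^ (-b) + (T - u) ^ (-b))) := by gcongr
          _ ≤ _ := mul_le_of_le_one_left (by positivity) (sin_sq_le_one u)
      have b2 : |sin u * cos u * (S (T - u) - S u)| ≤ 3 * (u ^ (-b) + (T - u) ^ (-b)) := by
        rw [abs_mul, abs_mul]
        have hle : |S (T - u) - S u| ≤ 3 * (u ^ (-b) + (T - u) ^ (-b)) := by
          rw [abs_le]; constructor <;> linarith [a3.1, a3.2, a4.1, a4.2]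
        have hsc1 : |sin u| * |cos u| ≤ 1 :=
          mul_le_one₀ (abs_sin_le_one u) (abs_nonneg _) (abs_cos_le_one u)
        exact (mul_le_of_le_one_left (abs_nonneg _) hsc1).trans hle
      linarith [(abs_le.1 b2).1]

/-- For large `r` the sine energy on `[0, t]²` at frequency `r` is at least of order
`r ^ (b - 1)`. -/
lemma exists_le_integral_sin_mul_freq {b t : ℝ} (hb : 0 < b) (hb' : b < 1) (ht : 0 < t) :
    ∃ c : ℝ, 0 < c ∧ ∃ R : ℝ, 1 ≤ R ∧ ∀ r : ℝ, R ≤ r → c * r ^ (b - 1) ≤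
      ∫ u in (0 : ℝ)..t, ∫ v in (0 : ℝ)..t, sin (u * r) * sin (v * r) * |u - v| ^ (-b) := by
  obtain ⟨c, hc, hle⟩ := exists_pos_le_integral_sin_mul_sin_mul_abs_sub_rpow hb hb'
  have hev : ∀ᶠ T : ℝ in Filter.atTop, c / 2 * T ≤ c * (T - 1) - 12 / (1 - b) * T ^ (1 - b) := by
    have h1b : 0 < 1 - b := by linarith
    filter_upwards [(tendsto_rpow_neg_atTop hb).eventually_le_const
      (show 0 < c * (1 - b) / 48 by positivity), Filter.eventually_ge_atTop 4] with T hT hT4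
    have hpow : T ^ (1 - b) = T ^ (-b) * T := by
      rw [← rpow_add_one (by positivity)]; congr 1; ring
    have h1 : 12 / (1 - b) * T ^ (1 - b) ≤ 12 / (1 - b) * (c * (1 - b) / 48 * T) := by
      rw [hpow]; gcongr
    have h2 : 12 / (1 - b) * (c * (1 - b) / 48 * T) = c * T / 4 := by field_simp; norm_num
    nlinarith
  obtain ⟨T₀, hT₀⟩ := Filter.eventually_atTop.1 hev
  refine ⟨c / 2 * t, by positivity, max 1 (T₀ / t), le_max_left _ _, fun r hr => ?_⟩
  have hr0 : 0 < r := one_pos.trans_le ((le_max_left _ _).trans hr)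
  have hTr : T₀ ≤ t * r := by
    have := (le_max_right _ _).trans hr
    rwa [div_le_iff₀' ht] at this
  have hscale : ∫ u in (0 : ℝ)..t, ∫ v in (0 : ℝ)..t,
        sin (u * r) * sin (v * r) * |u - v| ^ (-b) =
      r ^ b * (r⁻¹ * (r⁻¹ * ∫ u in (0 : ℝ)..(t * r), ∫ v in (0 : ℝ)..(t * r),
        sin u * sin v * |u - v| ^ (-b))) := by
    have h1 := intervalIntegral.integral_comp_mul_right (a := 0) (b := t)
      (fun u => ∫ v in (0 : ℝ)..(t * r), sin u * sin v * |u - v| ^ (-b)) hr0.ne'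
    rw [zero_mul, smul_eq_mul] at h1
    rw [mul_left_comm r⁻¹, ← h1, ← intervalIntegral.integral_const_mul,
      ← intervalIntegral.integral_const_mul]
    refine intervalIntegral.integral_congr fun u _ => ?_
    have h2 := intervalIntegral.integral_comp_mul_right (a := 0) (b := t)
      (fun v => sin (u * r) * sin v * |u * r - v| ^ (-b)) hr0.ne'
    rw [zero_mul, smul_eq_mul] at h2
    rw [← h2, ← intervalIntegral.integral_const_mul]
    refine intervalIntegral.integral_congr fun v _ => ?_
    rw [← sub_mul, abs_mul, abs_of_pos hr0, mul_rpow (abs_nonneg _) hr0.le, rpow_neg hr0.le]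
    have := (rpow_pos_of_pos hr0 b).ne'
    field_simp
  rw [hscale]
  calc c / 2 * t * r ^ (b - 1) = r ^ b * (r⁻¹ * (r⁻¹ * (c / 2 * (t * r)))) := by
        rw [rpow_sub_one hr0.ne']; field_simp
    _ ≤ _ := by
      gcongr
      exact (hT₀ _ hTr).trans (hle _ (by positivity))

/-- Proposition 3.8 (b). -/
theorem wave_necessity_large_freq (H : ℝ) (hH : H ∈ Set.Ioo (1/2 : ℝ) 1) (d : ℕ)
    (μ : Measure (EuclideanSpace ℝ (Fin d)))
    (htemp : ∃ l : ℕ, 1 ≤ l ∧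
      ∫⁻ ξ in {ξ : EuclideanSpace ℝ (Fin d) | 1 ≤ ‖ξ‖},
        ENNReal.ofReal (‖ξ‖ ^ (-(2 * (l : ℝ)))) ∂μ < ⊤)
    (hfin : ∃ t : ℝ, 0 < t ∧
      ∫⁻ ξ in {ξ : EuclideanSpace ℝ (Fin d) | 1 ≤ ‖ξ‖},
        ENNReal.ofReal (H * (2 * H - 1) * ‖ξ‖ ^ (-2 : ℝ) *
          ∫ u in (0 : ℝ)..t, ∫ v in (0 : ℝ)..t,
            Real.sin (u * ‖ξ‖) * Real.sin (v * ‖ξ‖) * |u - v| ^ (2 * H - 2)) ∂μ < ⊤) :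
    ∫⁻ ξ in {ξ : EuclideanSpace ℝ (Fin d) | 1 ≤ ‖ξ‖},
      ENNReal.ofReal (‖ξ‖ ^ (-(2 * H + 1))) ∂μ < ⊤ := by
  obtain ⟨l, -, hl⟩ := htemp
  obtain ⟨t, ht, hfin⟩ := hfin
  obtain ⟨hH1, hH2⟩ := hH
  obtain ⟨c, hc, R, hR, hle⟩ := exists_le_integral_sin_mul_freq (b := 2 - 2 * H) (by linarith)
    (by linarith) ht
  rw [show -(2 - 2 * H) = 2 * H - 2 by ring] at hle
  have hα : 0 < H * (2 * H - 1) := mul_pos (by linarith) (by linarith)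
  set K : ℝ := H * (2 * H - 1) * c with hK
  have hKpos : 0 < K := mul_pos hα hc
  have hmeas : Measurable fun ξ : EuclideanSpace ℝ (Fin d) =>
      ENNReal.ofReal (R ^ (2 * (l : ℝ))) * ENNReal.ofReal (‖ξ‖ ^ (-(2 * (l : ℝ)))) := by
    fun_prop
  refine (setLIntegral_mono' (measurableSet_le measurable_const measurable_norm)
    (g := fun ξ => ENNReal.ofReal (R ^ (2 * (l : ℝ))) * ENNReal.ofReal (‖ξ‖ ^ (-(2 * (l : ℝ)))) +
      ENNReal.ofReal K⁻¹ * ENNReal.ofReal (H * (2 * H - 1) * ‖ξ‖ ^ (-2 : ℝ) *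
          ∫ u in (0 : ℝ)..t, ∫ v in (0 : ℝ)..t,
            Real.sin (u * ‖ξ‖) * Real.sin (v * ‖ξ‖) * |u - v| ^ (2 * H - 2)))
    fun ξ hξ => ?_).trans_lt ?_
  · have hξ1 : 1 ≤ ‖ξ‖ := hξ
    have hξ0 : 0 < ‖ξ‖ := one_pos.trans_le hξ1
    rw [← ENNReal.ofReal_mul (by positivity), ← ENNReal.ofReal_mul (by positivity)]
    rcases le_total ‖ξ‖ R with h | h
    · refine le_add_right (ENNReal.ofReal_le_ofReal ?_)
      calc ‖ξ‖ ^ (-(2 * H + 1)) ≤ 1 := rpow_le_one_of_one_le_of_nonpos hξ1 (by linarith)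
        _ = ‖ξ‖ ^ (2 * (l : ℝ)) * ‖ξ‖ ^ (-(2 * (l : ℝ))) := by
          rw [← rpow_add hξ0, add_neg_cancel, rpow_zero]
        _ ≤ _ := by gcongr
    · refine le_add_left (ENNReal.ofReal_le_ofReal ?_)
      calc ‖ξ‖ ^ (-(2 * H + 1))
          = K⁻¹ * (H * (2 * H - 1) * ‖ξ‖ ^ (-2 : ℝ) * (c * ‖ξ‖ ^ (2 - 2 * H - 1))) := by
            rw [show -(2 * H + 1) = -2 + (2 - 2 * H - 1) by ring, rpow_add hξ0,
              eq_inv_mul_iff_mul_eq₀ hKpos.ne', hK]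
            ring
        _ ≤ _ := by
          gcongr
          exact hle _ h
  · rw [lintegral_add_left hmeas, lintegral_const_mul' _ _ ENNReal.ofReal_ne_top,
      lintegral_const_mul' _ _ ENNReal.ofReal_ne_top]
    exact ENNReal.add_lt_top.2 ⟨ENNReal.mul_lt_top ENNReal.ofReal_lt_top hl,
      ENNReal.mul_lt_top ENNReal.ofReal_lt_top hfin⟩
end

section
/- Let H ∈ (1/2, 1) and let μ be a nonnegative Borel measure on ℝ^d satisfying ∫_{ℝ^d} (1/(1+|ξ|²))^l μ(dξ) < ∞ for some integer l ≥ 1. Then the following are equivalent: (i) for every t > 0, I_t := α_H · ∫_{ℝ^d} (∫_0^t ∫_0^t h_{|ξ|}(u)·h_{|ξ|}(v)·|u−v|^{2H−2} du dv) μ(dξ) < ∞, where h_λ(u) = sin(uλ)/λ for λ > 0 and h_0(u) = u; (ii) ∫_{ℝ^d} (1/(1+|ξ|²))^{H+1/2} μ(dξ) < ∞. (Analytic core of Theorem 3.1: necessary and sufficient condition for the existence of the solution of the linear stochastic wave equation with fractional-in-time noise) -/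
open MeasureTheory Real

/-- The Fourier transform of the fundamental solution of the wave equation at a
frequency of modulus `l`, as a function of time `u` (with `h 0 u = u` by continuity). -/
noncomputable def waveKernelFT (l u : ℝ) : ℝ :=
  if l = 0 then u else Real.sin (u * l) / l

lemma integrableOn_abs_rpow {r : ℝ} (hr : -1 < r) (T : ℝ) :
    IntegrableOn (fun s : ℝ => |s| ^ r) (Set.Icc (-T) T) := by
  have hpos : IntegrableOn (fun s : ℝ => |s| ^ r) (Set.Icc 0 T) := by
    rcases le_or_gt 0 T with hT | hT
    · have h := (intervalIntegral.intervalIntegrable_rpow' (a := 0) (b := T) hr)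
      rw [intervalIntegrable_iff_integrableOn_Icc_of_le hT] at h
      exact h.congr_fun (fun s hs => by simp only [abs_of_nonneg hs.1]) measurableSet_Icc
    · simp [Set.Icc_eq_empty (not_le.2 hT)]
  have hneg : IntegrableOn (fun s : ℝ => |s| ^ r) (Set.Icc (-T) 0) := by
    have h := ((Measure.measurePreserving_neg (volume : Measure ℝ)).integrableOn_comp_preimage
      (Homeomorph.neg ℝ).measurableEmbedding).2 hpos
    simpa [Function.comp_def] using h
  refine (hneg.union hpos).mono_set fun s hs => ?_
  rcases le_total s 0 with h | h
  · exact Or.inl ⟨hs.1, h⟩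
  · exact Or.inr ⟨h, hs.2⟩

lemma integrable_abs_sub_rpow {r : ℝ} (hr : -1 < r) (T : ℝ) :
    Integrable (fun p : ℝ × ℝ => |p.1 - p.2| ^ r)
      ((volume.restrict (Set.Ioc 0 T)).prod (volume.restrict (Set.Ioc 0 T))) := by
  have hf : Integrable ((Set.Ioc 0 T).indicator (fun _ : ℝ => (1 : ℝ))) := by
    rw [integrable_indicator_iff measurableSet_Ioc]
    exact integrableOn_const (by simp)
  have hg := (integrable_indicator_iff measurableSet_Icc).2 (integrableOn_abs_rpow hr T)
  have h := hf.convolution_integrand (ContinuousLinearMap.mul ℝ ℝ) hg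
  rw [Measure.prod_restrict]
  refine IntegrableOn.congr_fun h.integrableOn (fun p hp => ?_)
    (measurableSet_Ioc.prod measurableSet_Ioc)
  obtain ⟨⟨h1, h2⟩, h3, h4⟩ := hp
  have h5 : p.1 - p.2 ∈ Set.Icc (-T) T := ⟨by linarith, by linarith⟩
  have h6 : p.2 ∈ Set.Ioc 0 T := ⟨h3, h4⟩
  simp [Set.indicator_of_mem h5, Set.indicator_of_mem h6]

lemma integrableOn_rpow_div_one_add_sq {a : ℝ} (ha : -1 < a) (ha' : a < 1) :
    IntegrableOn (fun x : ℝ => x ^ a / (1 + x ^ 2)) (Set.Ioi 0) := by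
  rw [← Set.Ioc_union_Ioi_eq_Ioi (zero_le_one' ℝ)]
  have hm : Measurable (fun x : ℝ => x ^ a / (1 + x ^ 2)) := by fun_prop
  refine IntegrableOn.union ?_ ?_
  · have h := intervalIntegral.intervalIntegrable_rpow' (a := 0) (b := 1) ha
    rw [intervalIntegrable_iff_integrableOn_Ioc_of_le zero_le_one] at h
    refine Integrable.mono' h hm.aestronglyMeasurable ?_
    filter_upwards [ae_restrict_mem measurableSet_Ioc] with x hx
    have := rpow_nonneg hx.1.le a
    rw [norm_of_nonneg (by positivity)]
    exact div_le_self this (by nlinarith [sq_nonneg x])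
  · have h := integrableOn_Ioi_rpow_of_lt (a := a - 2) (c := 1) (by linarith) one_pos
    refine Integrable.mono' h hm.aestronglyMeasurable ?_
    filter_upwards [ae_restrict_mem measurableSet_Ioi] with x hx
    have hx0 : (0 : ℝ) < x := lt_trans one_pos hx
    have := rpow_nonneg hx0.le a
    rw [norm_of_nonneg (by positivity), rpow_sub hx0, rpow_two]
    gcongr
    linarith

lemma integral_sin_mul_exp_sub (x u a b : ℝ) :
    ∫ v in a..b, sin v * exp (-(x * (u - v))) =
      (exp (-(x * (u - b))) * (x * sin b - cos b)
        - exp (-(x * (u - a))) * (x * sin a - cos a)) / (1 + x ^ 2) := by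
  have hx : (1 + x ^ 2) ≠ 0 := by positivity
  rw [intervalIntegral.integral_eq_sub_of_hasDerivAt
    (f := fun v => exp (-(x * (u - v))) * (x * sin v - cos v) / (1 + x ^ 2))]
  · ring
  · intro v _
    have h1 : HasDerivAt (fun v => exp (-(x * (u - v)))) (exp (-(x * (u - v))) * x) v := by
      simpa using (((hasDerivAt_id v).const_sub u).const_mul (-x)).exp
    have h2 := ((hasDerivAt_sin v).const_mul x).sub (hasDerivAt_cos v)
    refine ((h1.mul h2).div_const (1 + x ^ 2)).congr_deriv ?_
    rw [div_eq_iff hx]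
    simp only [Pi.sub_apply]
    ring
  · exact Continuous.intervalIntegrable (by fun_prop) _ _

lemma integral_sin_mul_exp_abs {x u T : ℝ} (hu : 0 ≤ u) (huT : u ≤ T) :
    ∫ v in (0 : ℝ)..T, sin v * exp (-(x * |u - v|)) =
      (exp (-(x * u)) + 2 * x * sin u - exp (-(x * (T - u))) * (x * sin T + cos T))
        / (1 + x ^ 2) := by
  have hc : Continuous fun v => sin v * exp (-(x * |u - v|)) := by fun_prop
  rw [← intervalIntegral.integral_add_adjacent_intervals (hc.intervalIntegrable 0 u)
    (hc.intervalIntegrable u T)]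
  have h1 : ∫ v in (0 : ℝ)..u, sin v * exp (-(x * |u - v|)) =
      ∫ v in (0 : ℝ)..u, sin v * exp (-(x * (u - v))) := by
    refine intervalIntegral.integral_congr fun v hv => ?_
    rw [Set.uIcc_of_le hu] at hv
    simp only [abs_of_nonneg (sub_nonneg.2 hv.2)]
  have h2 : ∫ v in u..T, sin v * exp (-(x * |u - v|)) =
      ∫ v in u..T, sin v * exp (-((-x) * (u - v))) := by
    refine intervalIntegral.integral_congr fun v hv => ?_
    rw [Set.uIcc_of_le huT] at hv
    simp only [abs_of_nonpos (sub_nonpos.2 hv.1)]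
    ring_nf
  rw [h1, h2, integral_sin_mul_exp_sub, integral_sin_mul_exp_sub]
  simp only [sub_self, sub_zero, mul_zero, neg_zero, exp_zero, sin_zero, cos_zero, neg_sq]
  rw [show -(-x * (u - T)) = -(x * (T - u)) by ring]
  ring

lemma integral_sin_sin_exp_abs {x T : ℝ} (hT : 0 ≤ T) :
    ∫ u in (0 : ℝ)..T, ∫ v in (0 : ℝ)..T, sin u * sin v * exp (-(x * |u - v|)) =
      (2 * x * (∫ u in (0 : ℝ)..T, sin u ^ 2)
        + (1 - exp (-(x * T)) * (x * sin T + cos T)) / (1 + x ^ 2)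
        - (x * sin T + cos T) * ((x * sin T - cos T + exp (-(x * T))) / (1 + x ^ 2)))
        / (1 + x ^ 2) := by
  have h1 : ∫ u in (0 : ℝ)..T, ∫ v in (0 : ℝ)..T, sin u * sin v * exp (-(x * |u - v|)) =
      ∫ u in (0 : ℝ)..T, (2 * x * sin u ^ 2 + sin u * exp (-((-x) * (0 - u)))
        - (x * sin T + cos T) * (sin u * exp (-(x * (T - u))))) / (1 + x ^ 2) := by
    refine intervalIntegral.integral_congr fun u hu => ?_
    rw [Set.uIcc_of_le hT] at hu
    simp only [mul_assoc, intervalIntegral.integral_const_mul]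
    rw [integral_sin_mul_exp_abs hu.1 hu.2]
    rw [show -(-x * (0 - u)) = -(x * u) by ring]
    ring
  have i1 : IntervalIntegrable (fun u => 2 * x * sin u ^ 2) volume 0 T :=
    Continuous.intervalIntegrable (by fun_prop) _ _
  have i2 : IntervalIntegrable (fun u => sin u * exp (-((-x) * (0 - u)))) volume 0 T :=
    Continuous.intervalIntegrable (by fun_prop) _ _
  have i3 : IntervalIntegrable (fun u => (x * sin T + cos T) * (sin u * exp (-(x * (T - u)))))
      volume 0 T := Continuous.intervalIntegrable (by fun_prop) _ _
  rw [h1, intervalIntegral.integral_div, intervalIntegral.integral_sub (i1.add i2) i3,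
    intervalIntegral.integral_add i1 i2, intervalIntegral.integral_const_mul,
    intervalIntegral.integral_const_mul, integral_sin_mul_exp_sub, integral_sin_mul_exp_sub]
  simp only [sub_self, sub_zero, zero_sub, mul_zero, neg_zero, exp_zero, sin_zero, cos_zero,
    neg_sq]
  rw [show -(-x * -T) = -(x * T) by ring]
  ring

lemma abs_integral_sin_sin_exp_abs_sub_le {x T : ℝ} (hx : 0 ≤ x) (hT : 0 ≤ T) :
    |(∫ u in (0 : ℝ)..T, ∫ v in (0 : ℝ)..T, sin u * sin v * exp (-(x * |u - v|)))
      - 2 * (∫ u in (0 : ℝ)..T, sin u ^ 2) * (x / (1 + x ^ 2))| ≤ 7 / (1 + x ^ 2) := by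
  rw [integral_sin_sin_exp_abs hT]
  have hp : 0 < 1 + x ^ 2 := by positivity
  set e := exp (-(x * T))
  have he0 : 0 ≤ e := (exp_pos _).le
  have he1 : e ≤ 1 := exp_le_one_iff.2 (by nlinarith [mul_nonneg hx hT])
  have hab : |x * sin T + cos T| ≤ x + 1 := by
    refine (abs_add_le _ _).trans (add_le_add ?_ (abs_cos_le_one T))
    rw [abs_mul, abs_of_nonneg hx]
    exact mul_le_of_le_one_right hx (abs_sin_le_one T)
  have hac : |x * sin T - cos T + e| ≤ x + 2 := by
    have : |x * sin T - cos T| ≤ x + 1 := by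
      refine (abs_sub _ _).trans (add_le_add ?_ (abs_cos_le_one T))
      rw [abs_mul, abs_of_nonneg hx]
      exact mul_le_of_le_one_right hx (abs_sin_le_one T)
    refine (abs_add_le _ _).trans ?_
    rw [abs_of_nonneg he0]
    linarith
  set p := x * sin T + cos T
  set q := x * sin T - cos T + e
  set S := ∫ u in (0 : ℝ)..T, sin u ^ 2
  have hep : |1 - e * p| ≤ x + 2 := by
    refine (abs_sub _ _).trans ?_
    rw [abs_mul, abs_of_nonneg he0, abs_one]
    nlinarith [abs_nonneg p]
  have hpq : |p * q| ≤ (x + 1) * (x + 2) := by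
    rw [abs_mul]
    exact mul_le_mul hab hac (abs_nonneg _) (by linarith)
  have key : (2 * x * S + (1 - e * p) / (1 + x ^ 2) - p * (q / (1 + x ^ 2))) / (1 + x ^ 2)
      - 2 * S * (x / (1 + x ^ 2)) = ((1 - e * p - p * q) / (1 + x ^ 2)) / (1 + x ^ 2) := by
    field_simp
    ring
  rw [key, abs_div, abs_of_pos hp]
  gcongr
  rw [abs_div, abs_of_pos hp, div_le_iff₀ hp]
  refine (abs_sub _ _).trans ?_
  nlinarith [sq_nonneg (x - 1)]

lemma integral_Ioi_rpow_mul_exp_neg_mul {g s : ℝ} (hg : 0 < g) (hs : 0 < s) :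
    ∫ x in Set.Ioi (0 : ℝ), x ^ (g - 1) * exp (-(x * s)) = Gamma g * s ^ (-g) := by
  simp only [mul_comm _ s]
  rw [integral_rpow_mul_exp_neg_mul_Ioi hg hs, one_div, inv_rpow hs.le, rpow_neg hs.le, mul_comm]

lemma integrableOn_Ioi_rpow_mul_exp_neg_mul {g s : ℝ} (hg : 0 < g) (hs : 0 < s) :
    IntegrableOn (fun x => x ^ (g - 1) * exp (-(x * s))) (Set.Ioi (0 : ℝ)) := by
  have h := integrableOn_rpow_mul_exp_neg_mul_rpow (p := 1) (s := g - 1) (b := s) (by linarith)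
    one_pos hs
  simpa [mul_comm s] using h

lemma ae_prod_fst_ne_snd (s : Set ℝ) :
    ∀ᵐ p ∂(volume.restrict s).prod (volume.restrict s), p.1 ≠ p.2 := by
  refine (Measure.ae_prod_iff_ae_ae ?_).2 (Filter.Eventually.of_forall fun u => ?_)
  · exact (measurableSet_eq_fun measurable_fst measurable_snd).compl
  · filter_upwards [Measure.ae_ne (volume.restrict s) u] with v hv using hv.symm

lemma integrable_sin_sin_rpow_exp {g : ℝ} (hg : 0 < g) (hg' : g < 1) (T : ℝ) :
    Integrable (fun p : (ℝ × ℝ) × ℝ =>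
      sin p.1.1 * sin p.1.2 * (p.2 ^ (g - 1) * exp (-(p.2 * |p.1.1 - p.1.2|))))
      (((volume.restrict (Set.Ioc 0 T)).prod (volume.restrict (Set.Ioc 0 T))).prod
        (volume.restrict (Set.Ioi 0))) := by
  have hm : Measurable (fun p : (ℝ × ℝ) × ℝ =>
      sin p.1.1 * sin p.1.2 * (p.2 ^ (g - 1) * exp (-(p.2 * |p.1.1 - p.1.2|)))) := by fun_prop
  have hae := ae_prod_fst_ne_snd (Set.Ioc 0 T)
  refine (integrable_prod_iff hm.aestronglyMeasurable).2 ⟨?_, ?_⟩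
  · filter_upwards [hae] with p hp
    exact (integrableOn_Ioi_rpow_mul_exp_neg_mul hg
      (abs_pos.2 (sub_ne_zero.2 hp))).const_mul _
  · have hJ := ((integrable_abs_sub_rpow (r := -g) (by linarith) T).const_mul (Gamma g)).bdd_mul
      (f := fun p : ℝ × ℝ => |sin p.1 * sin p.2|) (c := 1)
      (Continuous.aestronglyMeasurable (by fun_prop)) (Filter.Eventually.of_forall fun p => by
        rw [norm_eq_abs, abs_abs, abs_mul]
        exact mul_le_one₀ (abs_sin_le_one _) (abs_nonneg _) (abs_sin_le_one _))
    refine hJ.congr ?_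
    filter_upwards [hae] with p hp
    rw [← integral_Ioi_rpow_mul_exp_neg_mul hg (abs_pos.2 (sub_ne_zero.2 hp)),
      ← integral_const_mul]
    refine setIntegral_congr_fun measurableSet_Ioi fun x hx => ?_
    have := rpow_nonneg (le_of_lt hx) (g - 1)
    simp only [norm_mul, norm_eq_abs, abs_mul, abs_exp, abs_of_nonneg this]

lemma integrable_sin_sin_abs_sub_rpow {r : ℝ} (hr : -1 < r) (T : ℝ) :
    Integrable (fun p : ℝ × ℝ => sin p.1 * sin p.2 * |p.1 - p.2| ^ r)
      ((volume.restrict (Set.Ioc 0 T)).prod (volume.restrict (Set.Ioc 0 T))) :=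
  (integrable_abs_sub_rpow hr T).bdd_mul (c := 1)
    (Continuous.aestronglyMeasurable (by fun_prop)) (Filter.Eventually.of_forall fun p => by
      rw [norm_eq_abs, abs_mul]
      exact mul_le_one₀ (abs_sin_le_one _) (abs_nonneg _) (abs_sin_le_one _))

lemma integral_integral_eq_integral_prod_Ioc {T : ℝ} (hT : 0 ≤ T) {f : ℝ → ℝ → ℝ}
    (hf : Integrable (fun p : ℝ × ℝ => f p.1 p.2)
      ((volume.restrict (Set.Ioc 0 T)).prod (volume.restrict (Set.Ioc 0 T)))) :
    ∫ u in (0 : ℝ)..T, ∫ v in (0 : ℝ)..T, f u v =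
      ∫ p, f p.1 p.2 ∂(volume.restrict (Set.Ioc 0 T)).prod (volume.restrict (Set.Ioc 0 T)) := by
  rw [integral_prod _ hf]
  simp only [intervalIntegral.integral_of_le hT]

lemma integrableOn_and_integral_sin_sin_kernel {g : ℝ} (hg : 0 < g) (hg' : g < 1) {T : ℝ}
    (hT : 0 ≤ T) :
    IntegrableOn (fun x : ℝ => x ^ (g - 1) *
      ∫ u in (0 : ℝ)..T, ∫ v in (0 : ℝ)..T, sin u * sin v * exp (-(x * |u - v|))) (Set.Ioi 0) ∧
    Gamma g * (∫ u in (0 : ℝ)..T, ∫ v in (0 : ℝ)..T, sin u * sin v * |u - v| ^ (-g)) =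
      ∫ x in Set.Ioi (0 : ℝ), x ^ (g - 1) *
        ∫ u in (0 : ℝ)..T, ∫ v in (0 : ℝ)..T, sin u * sin v * exp (-(x * |u - v|)) := by
  have hF := integrable_sin_sin_rpow_exp hg hg' T
  have hx : ∀ x : ℝ, x ^ (g - 1) *
      (∫ u in (0 : ℝ)..T, ∫ v in (0 : ℝ)..T, sin u * sin v * exp (-(x * |u - v|))) =
      ∫ p, sin p.1 * sin p.2 * (x ^ (g - 1) * exp (-(x * |p.1 - p.2|)))
        ∂(volume.restrict (Set.Ioc 0 T)).prod (volume.restrict (Set.Ioc 0 T)) := by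
    intro x
    rw [integral_integral_eq_integral_prod_Ioc hT (f := fun u v =>
      sin u * sin v * exp (-(x * |u - v|))), ← integral_const_mul]
    · congr 1 with p
      ring
    · rw [Measure.prod_restrict]
      refine IntegrableOn.mono_set (t := Set.Icc 0 T ×ˢ Set.Icc 0 T) ?_
        (Set.prod_mono Set.Ioc_subset_Icc_self Set.Ioc_subset_Icc_self)
      exact (Continuous.continuousOn (by fun_prop)).integrableOn_compact
        (isCompact_Icc.prod isCompact_Icc)
  simp only [hx]
  refine ⟨hF.integral_prod_right, ?_⟩
  rw [← integral_integral_swap hF, integral_integral_eq_integral_prod_Ioc hT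
    (f := fun u v => sin u * sin v * |u - v| ^ (-g))
    (integrable_sin_sin_abs_sub_rpow (by linarith) T), ← integral_const_mul]
  refine integral_congr_ae ?_
  filter_upwards [ae_prod_fst_ne_snd (Set.Ioc 0 T)] with p hp
  rw [integral_const_mul, integral_Ioi_rpow_mul_exp_neg_mul hg (abs_pos.2 (sub_ne_zero.2 hp))]
  ring

/-- The quadratic form of the sine function for the kernel `|u - v| ^ (-g)` grows linearly. -/
lemma exists_abs_integral_sin_sin_kernel_sub_le {g : ℝ} (hg : 0 < g) (hg' : g < 1) :
    ∃ c C : ℝ, 0 < c ∧ ∀ T : ℝ, 0 ≤ T →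
      |(∫ u in (0 : ℝ)..T, ∫ v in (0 : ℝ)..T, sin u * sin v * |u - v| ^ (-g)) - c * T| ≤ C := by
  have hG := Gamma_pos_of_pos hg
  set a := ∫ x in Set.Ioi (0 : ℝ), x ^ g / (1 + x ^ 2) with ha
  set b := ∫ x in Set.Ioi (0 : ℝ), x ^ (g - 1) / (1 + x ^ 2) with hb
  have hia := integrableOn_rpow_div_one_add_sq (a := g) (by linarith) hg'
  have hib := integrableOn_rpow_div_one_add_sq (a := g - 1) (by linarith) (by linarith)
  have ha0 : 0 < a := by
    rw [ha, setIntegral_pos_iff_support_of_nonneg_ae _ hia]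
    · refine lt_of_lt_of_le (b := volume (Set.Ioi (0 : ℝ))) (by simp) (measure_mono fun x hx => ?_)
      have hx' : (0 : ℝ) < x := hx
      exact ⟨by simp only [Function.mem_support]; positivity, hx⟩
    · filter_upwards [ae_restrict_mem measurableSet_Ioi] with x hx
      have hx' : (0 : ℝ) < x := hx
      simp only [Pi.zero_apply]
      positivity
  refine ⟨a / Gamma g, (7 * b + a) / Gamma g, by positivity, fun T hT => ?_⟩
  obtain ⟨hint, heq⟩ := integrableOn_and_integral_sin_sin_kernel hg hg' hT
  set G := ∫ u in (0 : ℝ)..T, ∫ v in (0 : ℝ)..T, sin u * sin v * |u - v| ^ (-g)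
  set S := ∫ u in (0 : ℝ)..T, sin u ^ 2 with hS
  have h1 : |Gamma g * G - 2 * S * a| ≤ 7 * b := by
    rw [heq, ha, hb, ← integral_const_mul, ← integral_const_mul,
      ← integral_sub hint (hia.const_mul _), ← norm_eq_abs]
    refine norm_integral_le_of_norm_le (hib.const_mul 7) ?_
    filter_upwards [ae_restrict_mem measurableSet_Ioi] with x hx
    have hx' : (0 : ℝ) < x := hx
    have hxg : x ^ g = x ^ (g - 1) * x := by rw [rpow_sub_one hx'.ne']; field_simp
    have := abs_integral_sin_sin_exp_abs_sub_le hx'.le hT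
    rw [hxg, norm_eq_abs]
    calc _ = x ^ (g - 1) * _ := by
          rw [← abs_of_nonneg (rpow_nonneg hx'.le (g - 1)), ← abs_mul, abs_of_nonneg
            (rpow_nonneg hx'.le (g - 1))]
          congr 1
          rw [mul_sub]
          congr 1
          rw [hS]
          ring
      _ ≤ _ := mul_le_mul_of_nonneg_left this (rpow_nonneg hx'.le _)
      _ = _ := by ring
  have h2 : |2 * S - T| ≤ 1 := by
    rw [hS, integral_sin_sq, sin_zero, abs_le]
    constructor <;> nlinarith [sin_sq_add_cos_sq T, sq_nonneg (sin T - cos T),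
      sq_nonneg (sin T + cos T)]
  have h3 : |Gamma g * G - a * T| ≤ 7 * b + a := by
    have : Gamma g * G - a * T = (Gamma g * G - 2 * S * a) + a * (2 * S - T) := by ring
    rw [this]
    refine (abs_add_le _ _).trans (add_le_add h1 ?_)
    rw [abs_mul, abs_of_pos ha0]
    exact mul_le_of_le_one_right ha0.le h2
  have h4 : G - a / Gamma g * T = (Gamma g * G - a * T) / Gamma g := by
    field_simp
  rw [h4, abs_div, abs_of_pos hG]
  gcongr

lemma integral_waveKernelFT_eq {l : ℝ} (hl : 0 < l) (t r : ℝ) :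
    ∫ u in (0 : ℝ)..t, ∫ v in (0 : ℝ)..t, waveKernelFT l u * waveKernelFT l v * |u - v| ^ r =
      l ^ (-(r + 4)) *
        ∫ u in (0 : ℝ)..(l * t), ∫ v in (0 : ℝ)..(l * t), sin u * sin v * |u - v| ^ r := by
  have h0 : l * 0 = 0 := mul_zero l
  have hinner : ∀ u, ∫ v in (0 : ℝ)..(l * t), sin u * sin v * |u - v| ^ r =
      l * ∫ v in (0 : ℝ)..t, sin u * sin (l * v) * |u - l * v| ^ r := by
    intro u
    have := intervalIntegral.smul_integral_comp_mul_left (a := 0) (b := t)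
      (fun v => sin u * sin v * |u - v| ^ r) l
    rw [h0, smul_eq_mul] at this
    exact this.symm
  have houter := intervalIntegral.smul_integral_comp_mul_left (a := 0) (b := t)
      (fun u => ∫ v in (0 : ℝ)..(l * t), sin u * sin v * |u - v| ^ r) l
  rw [h0, smul_eq_mul] at houter
  rw [← houter]
  simp only [hinner, ← intervalIntegral.integral_const_mul]
  refine intervalIntegral.integral_congr fun u _ => intervalIntegral.integral_congr fun v _ => ?_
  have hl4 : l ^ (-(r + 4)) * l ^ r * l ^ 4 = 1 := by
    rw [← rpow_add hl, ← rpow_natCast, ← rpow_add hl]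
    norm_num
  simp only [waveKernelFT, if_neg hl.ne', ← mul_sub, abs_mul, abs_of_pos hl,
    mul_rpow hl.le (abs_nonneg _)]
  rw [mul_comm u l, mul_comm v l]
  calc _ = (l ^ (-(r + 4)) * l ^ r * l ^ 4) *
        (sin (l * u) / l * (sin (l * v) / l) * |u - v| ^ r) := by rw [hl4, one_mul]
    _ = _ := by field_simp

lemma abs_waveKernelFT_le (l u : ℝ) : |waveKernelFT l u| ≤ |u| := by
  unfold waveKernelFT
  split_ifs with h
  · rfl
  · rw [abs_div, div_le_iff₀ (abs_pos.2 h), ← abs_mul]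
    exact abs_sin_le_abs

lemma measurable_waveKernelFT (l : ℝ) : Measurable (waveKernelFT l) := by
  unfold waveKernelFT
  split_ifs <;> fun_prop

lemma exists_abs_integral_waveKernelFT_le {r : ℝ} (hr : -1 < r) {t : ℝ} (ht : 0 ≤ t) :
    ∃ M : ℝ, 0 ≤ M ∧ ∀ l : ℝ,
      |∫ u in (0 : ℝ)..t, ∫ v in (0 : ℝ)..t,
        waveKernelFT l u * waveKernelFT l v * |u - v| ^ r| ≤ M := by
  have hJ := integrable_abs_sub_rpow hr t
  refine ⟨∫ p, t * t * |p.1 - p.2| ^ r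
    ∂(volume.restrict (Set.Ioc 0 t)).prod (volume.restrict (Set.Ioc 0 t)),
    integral_nonneg fun p => by positivity, fun l => ?_⟩
  have hb : ∀ᵐ p : ℝ × ℝ ∂(volume.restrict (Set.Ioc 0 t)).prod (volume.restrict (Set.Ioc 0 t)),
      ‖waveKernelFT l p.1 * waveKernelFT l p.2‖ ≤ t * t := by
    rw [Measure.prod_restrict]
    filter_upwards [ae_restrict_mem (measurableSet_Ioc.prod measurableSet_Ioc)] with p hp
    obtain ⟨⟨h1, h2⟩, h3, h4⟩ := hp
    rw [norm_mul]
    refine mul_le_mul ((abs_waveKernelFT_le l _).trans ?_) ((abs_waveKernelFT_le l _).trans ?_)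
      (norm_nonneg _) ht
    · rwa [abs_of_pos h1]
    · rwa [abs_of_pos h3]
  have hm := measurable_waveKernelFT l
  have hi := hJ.bdd_mul (f := fun p : ℝ × ℝ => waveKernelFT l p.1 * waveKernelFT l p.2)
    (Measurable.aestronglyMeasurable (by fun_prop)) hb
  rw [integral_integral_eq_integral_prod_Ioc ht (f := fun u v =>
    waveKernelFT l u * waveKernelFT l v * |u - v| ^ r) hi, ← norm_eq_abs]
  refine norm_integral_le_of_norm_le (hJ.const_mul _) ?_
  filter_upwards [hb] with p hp
  rw [norm_mul, norm_of_nonneg (by positivity : 0 ≤ |p.1 - p.2| ^ r)]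
  gcongr

lemma exists_integral_waveKernelFT_le {H : ℝ} (hH : H ∈ Set.Ioo (1 / 2 : ℝ) 1) {t : ℝ}
    (ht : 0 < t) :
    ∃ M : ℝ, 0 ≤ M ∧ ∀ l : ℝ, 0 ≤ l →
      ∫ u in (0 : ℝ)..t, ∫ v in (0 : ℝ)..t,
        waveKernelFT l u * waveKernelFT l v * |u - v| ^ (2 * H - 2) ≤
      M * (1 / (1 + l ^ 2)) ^ (H + 1 / 2) := by
  obtain ⟨hH1, hH2⟩ := hH
  obtain ⟨M, hM, hlow⟩ := exists_abs_integral_waveKernelFT_le (r := 2 * H - 2) (by linarith) ht.le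
  obtain ⟨c, C, hc, hhigh⟩ := exists_abs_integral_sin_sin_kernel_sub_le (g := 2 - 2 * H)
    (by linarith) (by linarith)
  have hC : 0 ≤ C := (abs_nonneg _).trans (hhigh 0 le_rfl)
  refine ⟨(M + (c * t + C)) * 2 ^ (H + 1 / 2), by positivity, fun l hl => ?_⟩
  rw [mul_assoc, ← mul_rpow zero_le_two (by positivity)]
  rcases le_or_gt l 1 with h1 | h1
  · have : 1 ≤ (2 * (1 / (1 + l ^ 2))) ^ (H + 1 / 2) := by
      refine one_le_rpow ?_ (by linarith)
      rw [mul_one_div, le_div_iff₀ (by positivity)]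
      nlinarith
    calc _ ≤ M := (le_abs_self _).trans (hlow l)
      _ ≤ (M + (c * t + C)) * 1 := by nlinarith [mul_pos hc ht]
      _ ≤ _ := by gcongr
  · have hl0 : 0 < l := by linarith
    rw [integral_waveKernelFT_eq hl0]
    have h2 := (abs_le.1 (hhigh (l * t) (by positivity))).2
    rw [neg_sub] at h2
    have h3 : l ^ (-(2 * H - 2 + 4)) * l = (1 / l ^ 2) ^ (H + 1 / 2) := by
      rw [← rpow_add_one hl0.ne', one_div, inv_rpow (by positivity), ← rpow_natCast l 2,
        ← rpow_mul hl0.le, ← rpow_neg hl0.le]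
      congr 1
      push_cast
      ring
    calc _ ≤ l ^ (-(2 * H - 2 + 4)) * ((M + (c * t + C)) * l) := by
          gcongr
          nlinarith
      _ = (M + (c * t + C)) * (1 / l ^ 2) ^ (H + 1 / 2) := by rw [← h3]; ring
      _ ≤ _ := by
          have h4 : 1 / l ^ 2 ≤ 2 * (1 / (1 + l ^ 2)) := by
            rw [mul_one_div, div_le_div_iff₀ (by positivity) (by positivity)]
            nlinarith
          gcongr

lemma exists_le_integral_waveKernelFT {H : ℝ} (hH : H ∈ Set.Ioo (1 / 2 : ℝ) 1) :
    ∃ M R : ℝ, 0 ≤ M ∧ ∀ l : ℝ, R < l →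
      (1 / (1 + l ^ 2)) ^ (H + 1 / 2) ≤ M *
        ∫ u in (0 : ℝ)..1, ∫ v in (0 : ℝ)..1,
          waveKernelFT l u * waveKernelFT l v * |u - v| ^ (2 * H - 2) := by
  obtain ⟨hH1, hH2⟩ := hH
  obtain ⟨c, C, hc, hhigh⟩ := exists_abs_integral_sin_sin_kernel_sub_le (g := 2 - 2 * H)
    (by linarith) (by linarith)
  have hC : 0 ≤ C := (abs_nonneg _).trans (hhigh 0 le_rfl)
  refine ⟨2 / c, 2 * C / c, by positivity, fun l hl => ?_⟩
  have hl0 : 0 < l := lt_of_le_of_lt (by positivity) hl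
  rw [div_lt_iff₀ hc] at hl
  rw [integral_waveKernelFT_eq hl0, mul_one]
  have h2 := (abs_le.1 (hhigh l hl0.le)).1
  rw [neg_sub] at h2
  have h3 : l ^ (-(2 * H - 2 + 4)) * l = (1 / l ^ 2) ^ (H + 1 / 2) := by
    rw [← rpow_add_one hl0.ne', one_div, inv_rpow (by positivity), ← rpow_natCast l 2,
      ← rpow_mul hl0.le, ← rpow_neg hl0.le]
    congr 1
    push_cast
    ring
  calc (1 / (1 + l ^ 2)) ^ (H + 1 / 2) ≤ (1 / l ^ 2) ^ (H + 1 / 2) := by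
        gcongr
        linarith
    _ = 2 / c * (l ^ (-(2 * H - 2 + 4)) * (c / 2 * l)) := by rw [← h3]; field_simp
    _ ≤ _ := by
        gcongr
        linarith

/-- Analytic core of Theorem 3.1: the solution of the linear stochastic wave equation
with fractional-in-time noise exists iff condition (8) holds. -/
theorem wave_existence_iff (H : ℝ) (hH : H ∈ Set.Ioo (1/2 : ℝ) 1) (d : ℕ)
    (μ : Measure (EuclideanSpace ℝ (Fin d)))
    (htemp : ∃ l : ℕ, 1 ≤ l ∧
      ∫⁻ ξ, ENNReal.ofReal ((1 / (1 + ‖ξ‖ ^ 2)) ^ (l : ℝ)) ∂μ < ⊤) :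
    (∀ t : ℝ, 0 < t →
      ∫⁻ ξ, ENNReal.ofReal (H * (2 * H - 1) *
        ∫ u in (0 : ℝ)..t, ∫ v in (0 : ℝ)..t,
          waveKernelFT ‖ξ‖ u * waveKernelFT ‖ξ‖ v * |u - v| ^ (2 * H - 2)) ∂μ < ⊤) ↔
    ∫⁻ ξ, ENNReal.ofReal ((1 / (1 + ‖ξ‖ ^ 2)) ^ (H + 1/2)) ∂μ < ⊤ := by
  have hα : 0 < H * (2 * H - 1) := mul_pos (by linarith [hH.1]) (by linarith [hH.1])
  constructor
  · intro h
    obtain ⟨n, -, hn⟩ := htemp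
    obtain ⟨M, R, hM, hMR⟩ := exists_le_integral_waveKernelFT hH
    set B := (1 + R ^ 2) ^ (n : ℝ) with hB
    have hB0 : 0 ≤ B := by positivity
    have hbound : ∀ ξ : EuclideanSpace ℝ (Fin d),
        ENNReal.ofReal ((1 / (1 + ‖ξ‖ ^ 2)) ^ (H + 1/2)) ≤
        ENNReal.ofReal (M / (H * (2 * H - 1))) * ENNReal.ofReal (H * (2 * H - 1) *
          ∫ u in (0 : ℝ)..1, ∫ v in (0 : ℝ)..1,
            waveKernelFT ‖ξ‖ u * waveKernelFT ‖ξ‖ v * |u - v| ^ (2 * H - 2)) +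
        ENNReal.ofReal B * ENNReal.ofReal ((1 / (1 + ‖ξ‖ ^ 2)) ^ (n : ℝ)) := by
      intro ξ
      rcases lt_or_ge R ‖ξ‖ with hR | hR
      · refine le_add_right ?_
        rw [← ENNReal.ofReal_mul (by positivity)]
        refine ENNReal.ofReal_le_ofReal ((hMR _ hR).trans_eq ?_)
        rw [← mul_assoc, div_mul_cancel₀ _ hα.ne']
      · refine le_add_left ?_
        rw [← ENNReal.ofReal_mul hB0, hB, ← mul_rpow (by positivity) (by positivity)]
        refine ENNReal.ofReal_le_ofReal ?_
        calc (1 / (1 + ‖ξ‖ ^ 2)) ^ (H + 1/2) ≤ 1 := by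
              refine rpow_le_one (by positivity) ?_ (by linarith [hH.1])
              rw [div_le_one (by positivity)]
              nlinarith [sq_nonneg ‖ξ‖]
          _ ≤ _ := by
              refine one_le_rpow ?_ (by positivity)
              rw [mul_one_div, le_div_iff₀ (by positivity)]
              nlinarith [norm_nonneg ξ]
    refine (lintegral_mono hbound).trans_lt ?_
    rw [lintegral_add_right _ (by fun_prop), lintegral_const_mul' _ _ ENNReal.ofReal_ne_top,
      lintegral_const_mul' _ _ ENNReal.ofReal_ne_top]
    exact ENNReal.add_lt_top.2 ⟨ENNReal.mul_lt_top ENNReal.ofReal_lt_top (h 1 one_pos),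
      ENNReal.mul_lt_top ENNReal.ofReal_lt_top hn⟩
  · intro h t ht
    obtain ⟨M, hM, hMl⟩ := exists_integral_waveKernelFT_le hH ht
    have hbound : ∀ ξ : EuclideanSpace ℝ (Fin d), ENNReal.ofReal (H * (2 * H - 1) *
          ∫ u in (0 : ℝ)..t, ∫ v in (0 : ℝ)..t,
            waveKernelFT ‖ξ‖ u * waveKernelFT ‖ξ‖ v * |u - v| ^ (2 * H - 2)) ≤
        ENNReal.ofReal (H * (2 * H - 1) * M) *
          ENNReal.ofReal ((1 / (1 + ‖ξ‖ ^ 2)) ^ (H + 1/2)) := by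
      intro ξ
      rw [← ENNReal.ofReal_mul (by positivity), mul_assoc _ M]
      exact ENNReal.ofReal_le_ofReal (mul_le_mul_of_nonneg_left (hMl _ (norm_nonneg ξ)) hα.le)
    refine (lintegral_mono hbound).trans_lt ?_
    rw [lintegral_const_mul' _ _ ENNReal.ofReal_ne_top]
    exact ENNReal.mul_lt_top ENNReal.ofReal_lt_top h
end

section
/- Let H ∈ (1/2, 1), d ≥ 1, and H_1, …, H_d ∈ (1/2, 1). Then ∫_{ℝ^d} (1/(1+|ξ|²))^{H+1/2} · ∏_{i=1}^d |ξ_i|^{−(2H_i−1)} dξ < ∞ if and only if ∑_{i=1}^d (2H_i − 1) > d − 2H − 1. (Example 3.4: fractional Brownian field case of condition (8)) -/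
open MeasureTheory Real

/-- A weighted one-dimensional Gaussian integral. -/
lemma integral_abs_rpow_mul_exp_neg_mul_sq {q t : ℝ} (hq : -1 < q) (ht : 0 < t) :
    ∫ x : ℝ, |x| ^ q * exp (-t * x ^ 2) = t ^ (-(q + 1) / 2) * Gamma ((q + 1) / 2) := by
  have h1 := integral_comp_abs (f := fun x : ℝ ↦ x ^ q * exp (-t * x ^ 2))
  have h2 := integral_rpow_mul_exp_neg_mul_rpow (p := 2) two_pos hq ht
  simp only [sq_abs] at h1
  simp only [rpow_ofNat] at h2
  rw [h1, h2]
  ring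

lemma integral_abs_rpow_mul_exp_neg_mul_sq_pos {q t : ℝ} (hq : -1 < q) (ht : 0 < t) :
    0 < ∫ x : ℝ, |x| ^ q * exp (-t * x ^ 2) := by
  rw [integral_abs_rpow_mul_exp_neg_mul_sq hq ht]
  have := Gamma_pos_of_pos (s := (q + 1) / 2) (by linarith)
  positivity

lemma integrable_abs_rpow_mul_exp_neg_mul_sq {q t : ℝ} (hq : -1 < q) (ht : 0 < t) :
    Integrable fun x : ℝ ↦ |x| ^ q * exp (-t * x ^ 2) :=
  Integrable.of_integral_ne_zero (integral_abs_rpow_mul_exp_neg_mul_sq_pos hq ht).ne'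

/-- A weighted Gaussian integral on Euclidean space factors over the coordinates. -/
lemma lintegral_prod_abs_rpow_mul_exp_neg_mul_norm_sq {ι : Type*} [Fintype ι] {q : ι → ℝ}
    (hq : ∀ i, -1 < q i) {t : ℝ} (ht : 0 < t) :
    ∫⁻ ξ : EuclideanSpace ℝ ι, ENNReal.ofReal ((∏ i, |ξ i| ^ q i) * exp (-t * ‖ξ‖ ^ 2)) =
      ENNReal.ofReal (t ^ (-(∑ i, (q i + 1)) / 2) * ∏ i, Gamma ((q i + 1) / 2)) := by
  have hfactor (x : ι → ℝ) :
      (∏ i, |x i| ^ q i) * exp (-t * ‖WithLp.toLp 2 x‖ ^ 2) =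
        ∏ i, (|x i| ^ q i * exp (-t * x i ^ 2)) := by
    rw [Finset.prod_mul_distrib, ← exp_sum, EuclideanSpace.norm_sq_eq, Finset.mul_sum]
    simp
  rw [← (PiLp.volume_preserving_toLp ι).lintegral_comp_emb
    (MeasurableEquiv.toLp 2 (ι → ℝ)).measurableEmbedding]
  simp only [hfactor]
  rw [volume_pi, ← ofReal_integral_eq_lintegral_ofReal
    (Integrable.fintype_prod fun i ↦ integrable_abs_rpow_mul_exp_neg_mul_sq (hq i) ht)
    (ae_of_all _ fun x ↦ by positivity)]
  rw [← volume_pi, integral_fintype_prod_volume_eq_prod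
    (fun i (x : ℝ) ↦ |x| ^ q i * exp (-t * x ^ 2))]
  simp only [integral_abs_rpow_mul_exp_neg_mul_sq (hq _) ht, Finset.prod_mul_distrib]
  rw [← rpow_sum_of_pos ht, ← Finset.sum_div, Finset.sum_neg_distrib]

/-- The Gamma integral representation of a negative power. -/
lemma lintegral_rpow_mul_exp_neg_mul_Ioi {p r : ℝ} (hp : 0 < p) (hr : 0 < r) :
    ∫⁻ t in Set.Ioi (0 : ℝ), ENNReal.ofReal (t ^ (p - 1) * exp (-(r * t))) =
      ENNReal.ofReal ((1 / r) ^ p * Gamma p) := by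
  have h := integral_rpow_mul_exp_neg_mul_Ioi hp hr
  rw [← h, ofReal_integral_eq_lintegral_ofReal]
  · refine Integrable.of_integral_ne_zero ?_
    rw [h]
    have := Gamma_pos_of_pos hp
    positivity
  · filter_upwards [ae_restrict_mem measurableSet_Ioi] with t ht
    have : 0 < t := ht
    positivity

lemma lintegral_rpow_mul_exp_neg_Ioi_lt_top_iff {p : ℝ} :
    ∫⁻ t in Set.Ioi (0 : ℝ), ENNReal.ofReal (t ^ (p - 1) * exp (-t)) < ⊤ ↔ 0 < p := by
  refine ⟨fun h ↦ ?_, fun h ↦ ?_⟩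
  · have hint : IntegrableOn (fun t : ℝ ↦ t ^ (p - 1)) (Set.Ioo 0 1) := by
      have hI : IntegrableOn (fun t : ℝ ↦ t ^ (p - 1) * exp (-t)) (Set.Ioi 0) := by
        refine (lintegral_ofReal_ne_top_iff_integrable (by fun_prop) ?_).1 h.ne
        filter_upwards [ae_restrict_mem measurableSet_Ioi] with t ht
        have : 0 < t := ht
        positivity
      refine ((hI.mono_set Set.Ioo_subset_Ioi_self).const_mul (exp 1)).mono'
        (by fun_prop) ?_
      filter_upwards [ae_restrict_mem measurableSet_Ioo] with t ht
      have h0 : 0 ≤ t ^ (p - 1) := rpow_nonneg ht.1.le _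
      have h1 : 1 ≤ exp 1 * exp (-t) := by
        rw [← exp_add]
        exact one_le_exp (by linarith [ht.2])
      rw [norm_of_nonneg h0]
      nlinarith
    have := (intervalIntegral.integrableOn_Ioo_rpow_iff one_pos).1 hint
    linarith
  · have := lintegral_rpow_mul_exp_neg_mul_Ioi h one_pos
    simp only [one_mul] at this
    rw [this]
    exact ENNReal.ofReal_lt_top

/-- Integrability of the Bessel kernel `(1 + ‖ξ‖²)⁻ᵖ` against a product of powers. -/
lemma lintegral_one_add_norm_sq_rpow_mul_prod_abs_rpow_lt_top_iff {ι : Type*} [Fintype ι]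
    {q : ι → ℝ} (hq : ∀ i, -1 < q i) {p : ℝ} (hp : 0 < p) :
    ∫⁻ ξ : EuclideanSpace ℝ ι,
        ENNReal.ofReal ((1 / (1 + ‖ξ‖ ^ 2)) ^ p * ∏ i, |ξ i| ^ q i) < ⊤ ↔
      ∑ i, (q i + 1) < 2 * p := by
  have hΓ : 0 < Gamma p := Gamma_pos_of_pos hp
  have hΓ' : 0 < ∏ i, Gamma ((q i + 1) / 2) :=
    Finset.prod_pos fun i _ ↦ Gamma_pos_of_pos (by linarith [hq i])
  have key : ENNReal.ofReal (Gamma p) * ∫⁻ ξ : EuclideanSpace ℝ ι,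
        ENNReal.ofReal ((1 / (1 + ‖ξ‖ ^ 2)) ^ p * ∏ i, |ξ i| ^ q i) =
      ENNReal.ofReal (∏ i, Gamma ((q i + 1) / 2)) * ∫⁻ t in Set.Ioi (0 : ℝ),
        ENNReal.ofReal (t ^ (p - (∑ i, (q i + 1)) / 2 - 1) * exp (-t)) := by
    calc
      _ = ∫⁻ ξ : EuclideanSpace ℝ ι, ∫⁻ t in Set.Ioi (0 : ℝ),
          ENNReal.ofReal (∏ i, |ξ i| ^ q i) *
            ENNReal.ofReal (t ^ (p - 1) * exp (-((1 + ‖ξ‖ ^ 2) * t))) := by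
        rw [← lintegral_const_mul' _ _ ENNReal.ofReal_ne_top]
        refine lintegral_congr fun ξ ↦ ?_
        rw [lintegral_const_mul' _ _ ENNReal.ofReal_ne_top,
          lintegral_rpow_mul_exp_neg_mul_Ioi hp (by positivity),
          ← ENNReal.ofReal_mul hΓ.le, ← ENNReal.ofReal_mul (by positivity)]
        congr 1
        ring
      _ = ∫⁻ t in Set.Ioi (0 : ℝ), ∫⁻ ξ : EuclideanSpace ℝ ι,
          ENNReal.ofReal (∏ i, |ξ i| ^ q i) *
            ENNReal.ofReal (t ^ (p - 1) * exp (-((1 + ‖ξ‖ ^ 2) * t))) :=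
        lintegral_lintegral_swap (by fun_prop)
      _ = _ := by
        rw [← lintegral_const_mul' _ _ ENNReal.ofReal_ne_top]
        refine setLIntegral_congr_fun measurableSet_Ioi fun t (ht : 0 < t) ↦ ?_
        have hsplit (ξ : EuclideanSpace ℝ ι) :
            ENNReal.ofReal (∏ i, |ξ i| ^ q i) *
              ENNReal.ofReal (t ^ (p - 1) * exp (-((1 + ‖ξ‖ ^ 2) * t))) =
            ENNReal.ofReal (t ^ (p - 1) * exp (-t)) *
              ENNReal.ofReal ((∏ i, |ξ i| ^ q i) * exp (-t * ‖ξ‖ ^ 2)) := by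
          rw [← ENNReal.ofReal_mul (by positivity), ← ENNReal.ofReal_mul (by positivity),
            show -((1 + ‖ξ‖ ^ 2) * t) = -t + -t * ‖ξ‖ ^ 2 by ring, exp_add]
          congr 1
          ring
        simp only [hsplit]
        rw [lintegral_const_mul' _ _ ENNReal.ofReal_ne_top,
          lintegral_prod_abs_rpow_mul_exp_neg_mul_norm_sq hq ht,
          ← ENNReal.ofReal_mul (by positivity), ← ENNReal.ofReal_mul hΓ'.le,
          show p - (∑ i, (q i + 1)) / 2 - 1 = (p - 1) + -(∑ i, (q i + 1)) / 2 by ring,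
          rpow_add ht]
        congr 1
        ring
  have hfin {c : ℝ} (hc : 0 < c) (x : ENNReal) : ENNReal.ofReal c * x < ⊤ ↔ x < ⊤ := by
    simp [ENNReal.mul_lt_top_iff, hc.not_ge]
    rintro rfl
    simp
  rw [← hfin hΓ, key, hfin hΓ', lintegral_rpow_mul_exp_neg_Ioi_lt_top_iff]
  constructor <;> intro h <;> linarith

/-- Example 3.4: condition (8) for the covariance of a fractional Brownian field. -/
theorem condition8_fBf (H : ℝ) (hH : H ∈ Set.Ioo (1/2 : ℝ) 1) (d : ℕ) (hd : 1 ≤ d)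
    (H' : Fin d → ℝ) (hH' : ∀ i, H' i ∈ Set.Ioo (1/2 : ℝ) 1) :
    (∫⁻ ξ : EuclideanSpace ℝ (Fin d),
        ENNReal.ofReal ((1 / (1 + ‖ξ‖ ^ 2)) ^ (H + 1/2) *
          ∏ i, |ξ i| ^ (-(2 * H' i - 1))) < ⊤) ↔
      (∑ i, (2 * H' i - 1)) > d - 2 * H - 1 := by
  rw [lintegral_one_add_norm_sq_rpow_mul_prod_abs_rpow_lt_top_iff
    (fun i ↦ by linarith [(hH' i).2]) (by linarith [hH.1])]
  simp only [Finset.sum_add_distrib, Finset.sum_neg_distrib, Finset.sum_const, Finset.card_univ,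
    Fintype.card_fin, nsmul_eq_mul, mul_one]
  constructor <;> intro h <;> linarith
end

section
/- Let H ∈ (1/2, 1). There exists a constant C_H > 0, depending only on H, such that for every t > 0 and every λ ≥ 0, (1/4)·min(t^{2H}, 1)·(1/(1+λ²))^{2H} ≤ A_t(λ) ≤ C_H·(t^{2H} + 1)·(1/(1+λ²))^{2H}. (Proposition 4.3) -/
open MeasureTheory Real

lemma intervalIntegrable_abs_sub_rpow {p : ℝ} (hp : -1 < p) (u a b : ℝ) :
    IntervalIntegrable (fun v : ℝ => |u - v| ^ p) volume a b := by
  have h : ∀ x y : ℝ, IntervalIntegrable (fun w : ℝ => |w| ^ p) volume x y := by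
    intro x y
    have := (intervalIntegral.intervalIntegrable_cpow' (a := x) (b := y) (r := (p : ℂ))
      (by simpa using hp)).norm
    simpa [Complex.norm_cpow_real] using this
  simpa using (h (u - a) (u - b)).comp_sub_left u

/-- The weighted kernel `e^{-um/2} e^{-vm/2} |u - v|^p`. -/
noncomputable def heatKernelWeight (m p u v : ℝ) : ℝ :=
  Real.exp (-(u * m) / 2) * Real.exp (-(v * m) / 2) * |u - v| ^ p

lemma heatKernelWeight_nonneg (m p u v : ℝ) : 0 ≤ heatKernelWeight m p u v := by
  unfold heatKernelWeight; positivity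

lemma intervalIntegrable_heatKernelWeight {p : ℝ} (hp : -1 < p) (m u a b : ℝ) :
    IntervalIntegrable (heatKernelWeight m p u) volume a b :=
  (intervalIntegrable_abs_sub_rpow hp u a b).continuousOn_mul
    (f := fun v => |u - v| ^ p)
    (g := fun v => Real.exp (-(u * m) / 2) * Real.exp (-(v * m) / 2))
    (by fun_prop)

lemma integral_abs_sub_rpow {p u s : ℝ} (hp : -1 < p) (hu : 0 ≤ u) (hus : u ≤ s) :
    ∫ v in (0 : ℝ)..s, |u - v| ^ p = (u ^ (p + 1) + (s - u) ^ (p + 1)) / (p + 1) := by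
  have h0 : (0 : ℝ) ^ (p + 1) = 0 := Real.zero_rpow (by linarith)
  rw [← intervalIntegral.integral_add_adjacent_intervals
    (intervalIntegrable_abs_sub_rpow hp u 0 u) (intervalIntegrable_abs_sub_rpow hp u u s)]
  have h1 : ∫ v in (0 : ℝ)..u, |u - v| ^ p = u ^ (p + 1) / (p + 1) := by
    have : ∫ v in (0 : ℝ)..u, |u - v| ^ p = ∫ v in (0 : ℝ)..u, (u - v) ^ p := by
      refine intervalIntegral.integral_congr fun v hv => ?_
      rw [Set.uIcc_of_le hu] at hv
      simp only [abs_of_nonneg (sub_nonneg.2 hv.2)]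
    rw [this, intervalIntegral.integral_comp_sub_left (fun x => x ^ p) u, sub_self, sub_zero,
      integral_rpow (Or.inl hp), h0, sub_zero]
  have h2 : ∫ v in u..s, |u - v| ^ p = (s - u) ^ (p + 1) / (p + 1) := by
    have : ∫ v in u..s, |u - v| ^ p = ∫ v in u..s, (v - u) ^ p := by
      refine intervalIntegral.integral_congr fun v hv => ?_
      rw [Set.uIcc_of_le hus] at hv
      simp only [abs_sub_comm u v, abs_of_nonneg (sub_nonneg.2 hv.1)]
    rw [this, intervalIntegral.integral_comp_sub_right (fun x => x ^ p) u, sub_self,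
      integral_rpow (Or.inl hp), h0, sub_zero]
  rw [h1, h2, add_div]

lemma intervalIntegrable_rpow_add_sub_rpow {q : ℝ} (hq : 0 < q) (s c : ℝ) :
    IntervalIntegrable (fun u : ℝ => (u ^ q + (s - u) ^ q) / c) volume 0 s := by
  apply Continuous.intervalIntegrable
  have h := Real.continuous_rpow_const hq.le
  exact (h.add (h.comp (continuous_const.sub continuous_id))).div_const c

lemma integral_rpow_add_sub_rpow {q : ℝ} (hq : 0 < q) (s : ℝ) :
    ∫ u in (0 : ℝ)..s, (u ^ q + (s - u) ^ q) / q = 2 * s ^ (q + 1) / (q * (q + 1)) := by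
  have h := Real.continuous_rpow_const hq.le
  have h0 : (0 : ℝ) ^ (q + 1) = 0 := Real.zero_rpow (by linarith)
  have h' : Continuous fun x : ℝ => (s - x) ^ q := h.comp (continuous_const.sub continuous_id)
  rw [intervalIntegral.integral_div, intervalIntegral.integral_add (h.intervalIntegrable _ _)
      (h'.intervalIntegrable _ _),
    intervalIntegral.integral_comp_sub_left (fun x => x ^ q) s, sub_self, sub_zero,
    integral_rpow (Or.inl (by linarith)), h0, sub_zero]
  have : q + 1 ≠ 0 := by linarith
  field_simp
  ring

lemma heatKernelWeight_le {m p u v : ℝ} (hm : 0 ≤ m) (hu : 0 ≤ u) (hv : 0 ≤ v) :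
    heatKernelWeight m p u v ≤ |u - v| ^ p := by
  unfold heatKernelWeight
  rw [← Real.exp_add]
  refine mul_le_of_le_one_left (by positivity) (Real.exp_le_one_iff.2 ?_)
  have := mul_nonneg hu hm
  have := mul_nonneg hv hm
  linarith

lemma integral_heatKernelWeight_le {m p u t : ℝ} (hm : 0 ≤ m) (hp : -1 < p)
    (hu : 0 ≤ u) (hut : u ≤ t) :
    ∫ v in (0 : ℝ)..t, heatKernelWeight m p u v ≤
      (u ^ (p + 1) + (t - u) ^ (p + 1)) / (p + 1) := by
  rw [← integral_abs_sub_rpow hp hu hut]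
  exact intervalIntegral.integral_mono_on (hu.trans hut)
    (intervalIntegrable_heatKernelWeight hp m u 0 t) (intervalIntegrable_abs_sub_rpow hp u 0 t)
    fun v hv => heatKernelWeight_le hm hu hv.1

lemma integral_heatKernelWeight_nonneg (m p u : ℝ) {t : ℝ} (ht : 0 ≤ t) :
    0 ≤ ∫ v in (0 : ℝ)..t, heatKernelWeight m p u v :=
  intervalIntegral.integral_nonneg ht fun v _ => heatKernelWeight_nonneg m p u v

lemma intervalIntegrable_integral_heatKernelWeight {m p t : ℝ} (hm : 0 ≤ m) (hp : -1 < p)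
    (ht : 0 ≤ t) :
    IntervalIntegrable (fun u => ∫ v in (0 : ℝ)..t, heatKernelWeight m p u v) volume 0 t := by
  have hmeas : StronglyMeasurable (fun u => ∫ v in (0 : ℝ)..t, heatKernelWeight m p u v) := by
    simp only [intervalIntegral.integral_of_le ht]
    apply StronglyMeasurable.integral_prod_right (f := heatKernelWeight m p)
    apply Measurable.stronglyMeasurable
    unfold Function.uncurry heatKernelWeight
    fun_prop
  refine (intervalIntegrable_rpow_add_sub_rpow (q := p + 1) (by linarith) t (p + 1)).mono_fun
    hmeas.aestronglyMeasurable ?_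
  rw [Set.uIoc_of_le ht]
  filter_upwards [ae_restrict_mem measurableSet_Ioc] with u hu
  rw [Real.norm_of_nonneg (integral_heatKernelWeight_nonneg m p u ht)]
  exact (integral_heatKernelWeight_le hm hp hu.1.le hu.2).trans (le_abs_self _)

lemma integral_integral_heatKernelWeight_le {m p t : ℝ} (hm : 0 ≤ m) (hp : -1 < p)
    (ht : 0 ≤ t) :
    ∫ u in (0 : ℝ)..t, ∫ v in (0 : ℝ)..t, heatKernelWeight m p u v ≤
      2 * t ^ (p + 2) / ((p + 1) * (p + 2)) := by
  have h := integral_rpow_add_sub_rpow (q := p + 1) (by linarith) t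
  rw [show p + 1 + 1 = p + 2 by ring] at h
  rw [← h]
  exact intervalIntegral.integral_mono_on ht
    (intervalIntegrable_integral_heatKernelWeight hm hp ht)
    (intervalIntegrable_rpow_add_sub_rpow (by linarith) t _)
    fun u hu => integral_heatKernelWeight_le hm hp hu.1 hu.2

lemma le_integral_integral_heatKernelWeight {m p s t : ℝ} (hm : 0 ≤ m) (hp : -1 < p)
    (hs : 0 ≤ s) (hst : s ≤ t) :
    Real.exp (-(s * m)) * (2 * s ^ (p + 2) / ((p + 1) * (p + 2))) ≤
      ∫ u in (0 : ℝ)..t, ∫ v in (0 : ℝ)..t, heatKernelWeight m p u v := by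
  have ht := hs.trans hst
  have h := integral_rpow_add_sub_rpow (q := p + 1) (by linarith) s
  rw [show p + 1 + 1 = p + 2 by ring] at h
  rw [← h, ← intervalIntegral.integral_const_mul]
  have hI := intervalIntegrable_integral_heatKernelWeight hm hp ht
  have hsub : Set.uIcc 0 s ⊆ Set.uIcc 0 t := by
    rw [Set.uIcc_of_le hs, Set.uIcc_of_le ht]; exact Set.Icc_subset_Icc_right hst
  calc _ ≤ ∫ u in (0 : ℝ)..s, ∫ v in (0 : ℝ)..t, heatKernelWeight m p u v := by
        refine intervalIntegral.integral_mono_on hs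
          ((intervalIntegrable_rpow_add_sub_rpow (by linarith) s _).const_mul _)
          (hI.mono_set hsub) fun u hu => ?_
        rw [← integral_abs_sub_rpow hp hu.1 hu.2, ← intervalIntegral.integral_const_mul]
        calc _ ≤ ∫ v in (0 : ℝ)..s, heatKernelWeight m p u v := by
              refine intervalIntegral.integral_mono_on hs
                ((intervalIntegrable_abs_sub_rpow hp u 0 s).const_mul _)
                (intervalIntegrable_heatKernelWeight hp m u 0 s) fun v hv => ?_
              unfold heatKernelWeight
              rw [← Real.exp_add]
              gcongr
              have := mul_le_mul_of_nonneg_right hu.2 hm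
              have := mul_le_mul_of_nonneg_right hv.2 hm
              linarith
          _ ≤ _ := intervalIntegral.integral_mono_interval le_rfl hs hst
              (.of_forall fun v => heatKernelWeight_nonneg m p u v)
              (intervalIntegrable_heatKernelWeight hp m u 0 t)
    _ ≤ _ := intervalIntegral.integral_mono_interval le_rfl hs hst
        (.of_forall fun u => integral_heatKernelWeight_nonneg m p u ht) hI

lemma integrable_abs_rpow_mul_exp {p b : ℝ} (hp : -1 < p) (hb : 0 < b) :
    Integrable (fun w : ℝ => |w| ^ p * Real.exp (-(b * |w|))) := by
  have hIoi : IntegrableOn (fun w : ℝ => |w| ^ p * Real.exp (-(b * |w|))) (Set.Ioi 0) := by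
    refine (integrableOn_rpow_mul_exp_neg_mul_rpow hp one_pos hb).congr_fun (fun w hw => ?_)
      measurableSet_Ioi
    simp [abs_of_pos (Set.mem_Ioi.1 hw)]
  have hIic : IntegrableOn (fun w : ℝ => |w| ^ p * Real.exp (-(b * |w|))) (Set.Iic 0) := by
    rw [integrableOn_Iic_iff_integrableOn_Iio]
    simpa using hIoi.comp_neg
  rw [← integrableOn_univ, ← Set.Iic_union_Ioi (a := (0 : ℝ))]
  exact hIic.union hIoi

lemma integral_abs_rpow_mul_exp {p b : ℝ} (hp : -1 < p) (hb : 0 < b) :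
    ∫ w : ℝ, |w| ^ p * Real.exp (-(b * |w|)) = 2 * ((1 / b) ^ (p + 1) * Real.Gamma (p + 1)) := by
  rw [integral_comp_abs (f := fun w : ℝ => w ^ p * Real.exp (-(b * w)))]
  have := Real.integral_rpow_mul_exp_neg_mul_Ioi (a := p + 1) (by linarith) hb
  rw [add_sub_cancel_right] at this
  rw [this]

lemma integral_integral_heatKernelWeight_le_gamma {m p t : ℝ} (hm : 0 < m) (hp : -1 < p)
    (ht : 0 ≤ t) :
    ∫ u in (0 : ℝ)..t, ∫ v in (0 : ℝ)..t, heatKernelWeight m p u v ≤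
      2 * Real.Gamma (p + 1) * (4 / m) ^ (p + 2) := by
  set K : ℝ := 2 * ((1 / (m / 4)) ^ (p + 1) * Real.Gamma (p + 1)) with hK
  have hb : 0 < m / 4 := by positivity
  have hK0 : 0 ≤ K := by
    have := Real.Gamma_pos_of_pos (show 0 < p + 1 by linarith)
    positivity
  have hinner : ∀ u ∈ Set.Icc 0 t, ∫ v in (0 : ℝ)..t, heatKernelWeight m p u v ≤
      Real.exp (-(m / 4) * u) * K := by
    intro u hu
    have hint : Integrable (fun v : ℝ => |u - v| ^ p * Real.exp (-(m / 4 * |u - v|))) :=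
      (integrable_abs_rpow_mul_exp hp hb).comp_sub_left u
    calc _ ≤ ∫ v in (0 : ℝ)..t, Real.exp (-(m / 4) * u) *
            (|u - v| ^ p * Real.exp (-(m / 4 * |u - v|))) := by
          refine intervalIntegral.integral_mono_on ht
            (intervalIntegrable_heatKernelWeight hp m u 0 t)
            (hint.intervalIntegrable.const_mul _) fun v hv => ?_
          unfold heatKernelWeight
          rw [mul_comm (|u - v| ^ p), ← mul_assoc, ← Real.exp_add, ← Real.exp_add]
          refine mul_le_mul_of_nonneg_right (Real.exp_le_exp.2 ?_) (by positivity)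
          have h1 : |u - v| ≤ u + v := abs_le.2 ⟨by linarith [hu.1], by linarith [hv.1]⟩
          have h2 := mul_le_mul_of_nonneg_left h1 hm.le
          have h3 := mul_nonneg hm.le hv.1
          linarith
      _ = Real.exp (-(m / 4) * u) *
            ∫ v in (0 : ℝ)..t, |u - v| ^ p * Real.exp (-(m / 4 * |u - v|)) :=
          intervalIntegral.integral_const_mul _ _
      _ ≤ _ := by
          gcongr
          rw [hK, ← integral_abs_rpow_mul_exp hp hb, ← integral_sub_left_eq_self
            (fun w : ℝ => |w| ^ p * Real.exp (-(m / 4 * |w|))) volume u,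
            intervalIntegral.integral_of_le ht]
          exact setIntegral_le_integral hint (.of_forall fun v => by positivity)
  have hexp : IntegrableOn (fun u => Real.exp (-(m / 4) * u)) (Set.Ioi 0) :=
    integrableOn_exp_mul_Ioi (by linarith) 0
  calc _ ≤ ∫ u in (0 : ℝ)..t, Real.exp (-(m / 4) * u) * K :=
        intervalIntegral.integral_mono_on ht
          (intervalIntegrable_integral_heatKernelWeight hm.le hp ht)
          (Continuous.intervalIntegrable (by fun_prop) _ _) hinner
    _ = (∫ u in (0 : ℝ)..t, Real.exp (-(m / 4) * u)) * K :=
        intervalIntegral.integral_mul_const _ _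
    _ ≤ (4 / m) * K := by
        gcongr
        rw [intervalIntegral.integral_of_le ht]
        refine (setIntegral_mono_set hexp (.of_forall fun u => by positivity)
          (Set.Ioc_subset_Ioi_self.eventuallyLE)).trans ?_
        rw [integral_exp_mul_Ioi (by linarith)]
        simp
    _ = _ := by
        rw [hK, show p + 2 = (p + 1) + 1 by ring, Real.rpow_add_one (x := 4 / m) (by positivity),
          one_div_div]
        ring

/-- Proposition 4.3: two-sided bound on the `𝓗(0,t)`-norm of the heat kernel in
Fourier mode of modulus `λ`. -/
theorem heat_A_bounds (H : ℝ) (hH : H ∈ Set.Ioo (1/2 : ℝ) 1) :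
    ∃ C : ℝ, 0 < C ∧
      ∀ t l : ℝ, 0 < t → 0 ≤ l →
        (1/4) * min (t ^ (2 * H)) 1 * (1 / (1 + l ^ 2)) ^ (2 * H) ≤
          H * (2 * H - 1) *
            ∫ u in (0 : ℝ)..t, ∫ v in (0 : ℝ)..t,
              Real.exp (-(u * l ^ 2) / 2) * Real.exp (-(v * l ^ 2) / 2) *
                |u - v| ^ (2 * H - 2) ∧
        H * (2 * H - 1) *
            ∫ u in (0 : ℝ)..t, ∫ v in (0 : ℝ)..t,
              Real.exp (-(u * l ^ 2) / 2) * Real.exp (-(v * l ^ 2) / 2) *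
                |u - v| ^ (2 * H - 2) ≤
          C * (t ^ (2 * H) + 1) * (1 / (1 + l ^ 2)) ^ (2 * H) := by
  obtain ⟨hH1, hH2⟩ := hH
  have hp : -1 < 2 * H - 2 := by linarith
  have hα : 0 < H * (2 * H - 1) := mul_pos (by linarith) (by linarith)
  have hΓ : 0 < Real.Gamma (2 * H - 2 + 1) := Real.Gamma_pos_of_pos (by linarith)
  have hcancel : ∀ x : ℝ, H * (2 * H - 1) *
      (2 * x / ((2 * H - 2 + 1) * (2 * H - 2 + 2))) = x := by
    intro x
    have h1 : H ≠ 0 := by linarith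
    have h2 : 2 * H - 1 ≠ 0 := by linarith
    rw [show 2 * H - 2 + 1 = 2 * H - 1 by ring, show 2 * H - 2 + 2 = 2 * H by ring]
    generalize 2 * H - 1 = y at h2
    field_simp
  set B : ℝ := H * (2 * H - 1) * (2 * Real.Gamma (2 * H - 2 + 1) * 8 ^ (2 * H)) with hB
  have hB0 : 0 < B := by positivity
  refine ⟨4 + B, by positivity, fun t l ht hl => ?_⟩
  set m : ℝ := l ^ 2
  have hm : 0 ≤ m := sq_nonneg l
  change _ ≤ H * (2 * H - 1) * (∫ u in (0 : ℝ)..t, ∫ v in (0 : ℝ)..t,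
      heatKernelWeight m (2 * H - 2) u v) ∧ H * (2 * H - 1) * (∫ u in (0 : ℝ)..t,
      ∫ v in (0 : ℝ)..t, heatKernelWeight m (2 * H - 2) u v) ≤ _
  have hx0 : (0 : ℝ) < 1 / (1 + m) := by positivity
  constructor
  · set s : ℝ := min t 1 * (1 / (1 + m)) with hs
    have hmin : 0 < min t 1 := lt_min ht one_pos
    have hs0 : 0 ≤ s := by positivity
    have hst : s ≤ t := by
      refine (mul_le_of_le_one_right hmin.le ?_).trans (min_le_left t 1)
      rw [div_le_one (by positivity)]; linarith
    have hsm : s * m ≤ 1 := by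
      calc s * m ≤ 1 * (1 / (1 + m)) * m := by rw [hs]; gcongr; exact min_le_right t 1
        _ ≤ 1 := by rw [one_mul, one_div_mul_eq_div, div_le_one (by positivity)]; linarith
    have hexp : (1 / 4 : ℝ) ≤ Real.exp (-(s * m)) := by
      have h1 : Real.exp (-1) ≤ Real.exp (-(s * m)) := Real.exp_le_exp.2 (by linarith)
      linarith [Real.exp_neg_one_gt_d9]
    have hpow : min (t ^ (2 * H)) 1 ≤ (min t 1) ^ (2 * H) := by
      rcases le_total t 1 with h | h
      · rw [min_eq_left h]; exact min_le_left _ _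
      · rw [min_eq_right h, Real.one_rpow]; exact min_le_right _ _
    have hlow := mul_le_mul_of_nonneg_left
      (le_integral_integral_heatKernelWeight hm hp hs0 hst) hα.le
    rw [mul_left_comm, hcancel, sub_add_cancel] at hlow
    refine le_trans ?_ hlow
    rw [hs, Real.mul_rpow hmin.le hx0.le, ← hs, mul_assoc]
    gcongr
  · rcases le_total m 1 with h | h
    · have hup := mul_le_mul_of_nonneg_left
        (integral_integral_heatKernelWeight_le hm hp ht.le) hα.le
      rw [hcancel, sub_add_cancel] at hup
      have hquarter : (1 / 4 : ℝ) ≤ (1 / (1 + m)) ^ (2 * H) := by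
        calc (1 / 4 : ℝ) = (1 / 2) ^ (2 : ℝ) := by norm_num
          _ ≤ (1 / 2) ^ (2 * H) :=
            Real.rpow_le_rpow_of_exponent_ge (by norm_num) (by norm_num) (by linarith)
          _ ≤ _ := by gcongr; linarith
      have htp : 0 ≤ t ^ (2 * H) := by positivity
      calc _ ≤ t ^ (2 * H) := hup
        _ ≤ 4 * (t ^ (2 * H) + 1) * (1 / 4) := by linarith
        _ ≤ _ := by gcongr; linarith
    · have hup := mul_le_mul_of_nonneg_left
        (integral_integral_heatKernelWeight_le_gamma (m := m) (by linarith) hp ht.le) hα.le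
      rw [sub_add_cancel] at hup
      have hpow : (4 / m) ^ (2 * H) ≤ 8 ^ (2 * H) * (1 / (1 + m)) ^ (2 * H) := by
        rw [← Real.mul_rpow (by norm_num) hx0.le]
        gcongr
        rw [mul_one_div, div_le_div_iff₀ (by linarith) (by positivity)]
        linarith
      have htp : 0 ≤ t ^ (2 * H) := by positivity
      calc _ ≤ _ := hup
        _ ≤ H * (2 * H - 1) * (2 * Real.Gamma (2 * H - 2 + 1) *
              (8 ^ (2 * H) * (1 / (1 + m)) ^ (2 * H))) := by gcongr
        _ = B * 1 * (1 / (1 + m)) ^ (2 * H) := by rw [hB]; ring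
        _ ≤ (4 + B) * (t ^ (2 * H) + 1) * (1 / (1 + m)) ^ (2 * H) := by gcongr <;> linarith
end
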